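/- For every U'(𝔥)-module V there is an isomorphism of U'(𝔤)-modules Φ : Ind'(V ⊗ k_{trad_{𝔤/𝔥}}) → Coind'(V) such that for every v ∈ V, Φ(1 ⊗ v) is the unique element λ_v ∈ Hom_{U'(𝔥)}(U'(𝔤), V) satisfying λ_v(e^a) = 0 for all a ≠ (p−1,…,p−1) and λ_v(e^{(p−1,…,p−1)}) = v. -/

import Mathlib

open TensorProduct

noncomputable section

/-- The relation on `U(𝔤)` whose closure defines the restricted enveloping algebra. -/
def rRel (k : Type*) [Field k] (L : Type*) [LieRing L] [LieAlgebra k L]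
    (p : ℕ) (pOp : L → L) :
    UniversalEnvelopingAlgebra k L → UniversalEnvelopingAlgebra k L → Prop :=
  fun x y => ∃ X : L,
    x = UniversalEnvelopingAlgebra.ι k X ^ p ∧ y = UniversalEnvelopingAlgebra.ι k (pOp X)

/-- The restricted enveloping algebra `U'(𝔤) = U(𝔤)/I`. -/
abbrev RUEA (k : Type*) [Field k] (L : Type*) [LieRing L] [LieAlgebra k L]
    (p : ℕ) (pOp : L → L) : Type _ :=
  RingQuot (rRel k L p pOp)

/-- `ι' : 𝔤 → U'(𝔤)`, the composite of `ι` with the quotient map. -/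
def rι (k : Type*) [Field k] {L : Type*} [LieRing L] [LieAlgebra k L]
    (p : ℕ) (pOp : L → L) (X : L) : RUEA k L p pOp :=
  RingQuot.mkAlgHom k (rRel k L p pOp) (UniversalEnvelopingAlgebra.ι k X)

/-- For `a ∈ {0,…,p−1}^n`, the ordered monomial `e^a = ι'(e_1)^{a_1} ⋯ ι'(e_n)^{a_n}`. -/
def eMonR (k : Type*) [Field k] {L : Type*} [LieRing L] [LieAlgebra k L]
    (p : ℕ) (pOp : L → L) {n : ℕ} (e : Fin n → L) (a : Fin n → Fin p) :
    RUEA k L p pOp :=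
  ((List.finRange n).map fun i => rι k p pOp (e i) ^ (a i : ℕ)).prod

/-- The endomorphism of `𝔤/𝔥` induced by `ad(h)` for `h ∈ 𝔥`. -/
def adQuot {k : Type*} [Field k] {L : Type*} [LieRing L] [LieAlgebra k L]
    (H : LieSubalgebra k L) (h : H) :
    (L ⧸ H.toSubmodule) →ₗ[k] (L ⧸ H.toSubmodule) :=
  Submodule.mapQ _ _ (LieAlgebra.ad k L (h : L)) (fun _ hx => H.lie_mem h.2 hx)

/-- `trad_{𝔤/𝔥} : 𝔥 → k`, the trace of the adjoint action of `𝔥` on `𝔤/𝔥`. -/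
def trad {k : Type*} [Field k] {L : Type*} [LieRing L] [LieAlgebra k L]
    (H : LieSubalgebra k L) (h : H) : k :=
  LinearMap.trace k (L ⧸ H.toSubmodule) (adQuot H h)

section

variable {k : Type*} [Field k] {L : Type*} [LieRing L] [LieAlgebra k L]
  (p : ℕ) (pOp : L → L) {H : LieSubalgebra k L} {pOpH : H → H}
  {V : Type*} [AddCommGroup V] [Module k V]

/-- The restricted coinduced module `Coind'(V) = Hom_{U'(𝔥)}(U'(𝔤), V)`, as the set
of `k`-linear maps `U'(𝔤) → V` that are `U'(𝔥)`-linear (`ρ` being the `U'(𝔥)`-module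
structure of `V` and `φ : U'(𝔥) → U'(𝔤)` the map induced by the inclusion). -/
def rCoindSet (φ : RUEA k H p pOpH →ₐ[k] RUEA k L p pOp)
    (ρ : RUEA k H p pOpH →ₐ[k] Module.End k V) :
    Set (RUEA k L p pOp →ₗ[k] V) :=
  {lam | ∀ (w : RUEA k H p pOpH) (u : RUEA k L p pOp),
    lam (φ w * u) = ρ w (lam u)}

/-- The subspace of relations presenting the restricted induced module
`Ind'(W) = U'(𝔤) ⊗_{U'(𝔥)} W` as a quotient of `U'(𝔤) ⊗_k W`. -/
def rIndRel (φ : RUEA k H p pOpH →ₐ[k] RUEA k L p pOp)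
    (ρ : RUEA k H p pOpH →ₐ[k] Module.End k V) :
    Submodule k (RUEA k L p pOp ⊗[k] V) :=
  Submodule.span k {x | ∃ (u : RUEA k L p pOp) (w : RUEA k H p pOpH) (v : V),
    x = (u * φ w) ⊗ₜ[k] v - u ⊗ₜ[k] (ρ w v)}

end

theorem exists_normalForm {k W A : Type*} [Field k] [AddCommGroup A] [Module k A]
    (β : Module.Basis W k A) {lt : W → W → Prop} (hwf : WellFounded lt) (R : W → A → Prop)
    (hlt : ∀ w f, R w f → f ∈ Submodule.span k (β '' {w' | lt w' w}))
    (hconf : ∀ w f f', R w f → R w f' →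
      f - f' ∈ Submodule.span k {x | ∃ w' g, R w' g ∧ lt w' w ∧ x = β w' - g}) :
    ∃ N : A →ₗ[k] A, (∀ w, (∀ f, ¬ R w f) → N (β w) = β w) ∧
      ∀ w f, R w f → N (β w) = N f := by
  classical
  let step : (w : W) → ((w' : W) → lt w' w → A) → A := fun w rec =>
    if h : ∃ f, R w f then
      (β.repr h.choose).sum fun w' c => if h' : lt w' w then c • rec w' h' else 0
    else β w
  let Nw : W → A := hwf.fix step
  have hNw (w) : Nw w = step w fun w' _ => Nw w' := hwf.fix_eq step w
  let N : A →ₗ[k] A := β.constr k Nw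
  have hN (w) : N (β w) = Nw w := β.constr_basis k Nw w
  have hchoose (w) (h : ∃ f, R w f) : N (β w) = N h.choose := by
    rw [hN, hNw]
    simp only [step, dif_pos h, N, Module.Basis.constr_apply]
    refine Finsupp.sum_congr fun w' hw' => ?_
    exact dif_pos ((β.mem_span_image).1 (hlt w _ h.choose_spec) hw')
  refine ⟨N, fun w hw => ?_, fun w => ?_⟩
  · rw [hN, hNw]
    simp only [step]
    rw [dif_neg (by simpa using hw)]
  · induction w using hwf.induction with
    | _ w ih =>
      intro f hf
      have h : ∃ f, R w f := ⟨f, hf⟩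
      rw [hchoose w h, ← sub_eq_zero, ← map_sub]
      have hle : Submodule.span k {x | ∃ w' g, R w' g ∧ lt w' w ∧ x = β w' - g} ≤
          LinearMap.ker N := by
        rw [Submodule.span_le]
        rintro x ⟨w', g, hR, hw', rfl⟩
        simp [ih w' hw' g hR]
      exact hle (hconf w _ _ h.choose_spec hf)

namespace FreeAlgebra

variable (k : Type*) [Field k] {X : Type*}

/-- The monomial of the free algebra attached to a word. -/
def word (w : List X) : FreeAlgebra k X := (w.map (ι k)).prod

@[simp] theorem word_nil : word k ([] : List X) = 1 := rfl

@[simp] theorem word_cons (i : X) (w : List X) : word k (i :: w) = ι k i * word k w := by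
  simp [word]

@[simp] theorem word_append (v w : List X) : word k (v ++ w) = word k v * word k w := by
  simp [word]

@[simp] theorem word_replicate (m : ℕ) (i : X) : word k (List.replicate m i) = ι k i ^ m := by
  simp [word]

variable (X) in
/-- The basis of words of the free algebra. -/
def wordBasis : Module.Basis (List X) k (FreeAlgebra k X) :=
  basisFreeMonoid k X

theorem wordBasis_apply (w : List X) : wordBasis k X w = word k w := by
  rw [wordBasis, basisFreeMonoid]
  change FreeAlgebra.equivMonoidAlgebraFreeMonoid.symm (MonoidAlgebra.of k _ (FreeMonoid.ofList w)) = _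
  simp [FreeAlgebra.equivMonoidAlgebraFreeMonoid, word, FreeMonoid.lift_apply]

theorem mem_span_word (a : FreeAlgebra k X) : a ∈ Submodule.span k (Set.range (word k)) := by
  rw [← funext (wordBasis_apply k), (wordBasis k X).span_eq]
  trivial

end FreeAlgebra

section

open FreeAlgebra Submodule

namespace RestrictedPBW

variable {k : Type*} [Field k] {X : Type*} {L : Type*} [LieRing L] [LieAlgebra k L]

/-- The linear embedding of a Lie algebra with a basis into the free algebra on the basis. -/
def lin (b : Module.Basis X k L) : L →ₗ[k] FreeAlgebra k X :=
  b.constr k (ι k)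

@[simp] theorem lin_basis (b : Module.Basis X k L) (i : X) : lin b (b i) = ι k i :=
  b.constr_basis k _ i

/-- The element `x y - y x - [x, y]` of the free algebra. -/
def comRel (b : Module.Basis X k L) :
    L →ₗ[k] L →ₗ[k] FreeAlgebra k X :=
  (LinearMap.mul k _).compl₁₂ (lin b) (lin b) - ((LinearMap.mul k _).compl₁₂ (lin b) (lin b)).flip
    - (LieModule.toEnd k L L : L →ₗ[k] Module.End k L).compr₂ (lin b)

theorem comRel_apply (b : Module.Basis X k L) (x y : L) :
    comRel b x y = lin b x * lin b y - lin b y * lin b x - lin b ⁅x, y⁆ := by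
  simp [comRel]

theorem comRel_swap (b : Module.Basis X k L) (x y : L) : comRel b y x = - comRel b x y := by
  rw [comRel_apply, comRel_apply, ← lie_skew x y, map_neg]
  abel

/-- The element `x_i ^ p - x_i^[p]` of the free algebra. -/
def powRel (b : Module.Basis X k L) (p : ℕ) (pOp : L → L) (i : X) :
    FreeAlgebra k X :=
  ι k i ^ p - lin b (pOp (b i))

variable {b : Module.Basis X k L} {p : ℕ} {pOp : L → L}

/-- The span of the commutator relations in words of length less than `n`. -/
def comSpan (b : Module.Basis X k L) (n : ℕ) : Submodule k (FreeAlgebra k X) :=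
  span k {x | ∃ u v : List X, ∃ y z : L, u.length + 2 + v.length < n ∧
    x = word k u * comRel b y z * word k v}

theorem mem_comSpan {n : ℕ} {u v : List X} (h : u.length + 2 + v.length < n) (y z : L) :
    word k u * comRel b y z * word k v ∈ comSpan b n :=
  subset_span ⟨u, v, y, z, h, rfl⟩

theorem comSpan_mono {m n : ℕ} (h : m ≤ n) : comSpan b m ≤ comSpan b n := by
  refine span_mono ?_
  rintro _ ⟨u, v, y, z, hl, rfl⟩
  exact ⟨u, v, y, z, by omega, rfl⟩

/-- The commutator with a generator, on the free algebra. -/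
def dGen (k : Type*) [Field k] {X : Type*} (i : X) : Module.End k (FreeAlgebra k X) :=
  LinearMap.mulLeft k (ι k i) - LinearMap.mulRight k (ι k i)

theorem dGen_apply (i : X) (x : FreeAlgebra k X) : dGen k i x = ι k i * x - x * ι k i := rfl

theorem dGen_mem_comSpan (i : X) {n : ℕ} {x : FreeAlgebra k X} (hx : x ∈ comSpan b n) :
    dGen k i x ∈ comSpan b (n + 1) := by
  induction hx using span_induction with
  | zero => simp
  | add x y _ _ hx hy => simpa using add_mem hx hy
  | smul c x _ hx => simpa using smul_mem _ c hx
  | mem x h =>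
    obtain ⟨u, v, y, z, hl, rfl⟩ := h
    have h1 := mem_comSpan (b := b) (n := n + 1) (u := i :: u) (v := v) (by simp; omega) y z
    have h2 := mem_comSpan (b := b) (n := n + 1) (u := u) (v := v ++ [i]) (by simp; omega) y z
    convert sub_mem h1 h2 using 1
    simp [dGen_apply, mul_assoc]

theorem mul_ι_mem_comSpan (i : X) {n : ℕ} {x : FreeAlgebra k X} (hx : x ∈ comSpan b n) :
    x * ι k i ∈ comSpan b (n + 1) := by
  induction hx using span_induction with
  | zero => simp
  | add x y _ _ hx hy => simpa [add_mul] using add_mem hx hy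
  | smul c x _ hx => simpa using smul_mem _ c hx
  | mem x h =>
    obtain ⟨u, v, y, z, hl, rfl⟩ := h
    simpa [mul_assoc] using
      mem_comSpan (b := b) (n := n + 1) (u := u) (v := v ++ [i]) (by simp; omega) y z

theorem dGen_pow_sub_mem (i : X) (z : L) (m : ℕ) :
    (dGen k i ^ (m + 1)) (lin b z) - lin b ((LieAlgebra.ad k L (b i) ^ (m + 1)) z)
      - (dGen k i ^ m) (comRel b (b i) z) ∈ comSpan b (m + 2) := by
  induction m with
  | zero => simp [dGen_apply, comRel_apply]
  | succ m ih =>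
    have h1 := dGen_mem_comSpan i ih
    set u := (LieAlgebra.ad k L (b i) ^ (m + 1)) z with hu
    have h2 : comRel b (b i) u ∈ comSpan b (m + 3) := by
      simpa using mem_comSpan (b := b) (n := m + 3) (u := []) (v := []) (by simp) (b i) u
    have hu' : (LieAlgebra.ad k L (b i) ^ (m + 1 + 1)) z = ⁅b i, u⁆ := by
      rw [pow_succ', Module.End.mul_apply, ← hu]
      rfl
    rw [hu', pow_succ' _ (m + 1), pow_succ' (dGen k i) m, Module.End.mul_apply,
      Module.End.mul_apply (dGen k i) (dGen k i ^ m) (comRel b (b i) z), ← pow_succ' _ m]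
    convert add_mem h1 h2 using 1
    rw [map_sub, map_sub, comRel_apply b (b i) u, lin_basis, dGen_apply i (lin b u),
      ← Module.End.mul_apply, ← pow_succ']
    abel

theorem dGen_pow_char (i : X) [CharP k p] [Fact p.Prime] (x : FreeAlgebra k X) :
    (dGen k i ^ p) x = ι k i ^ p * x - x * ι k i ^ p := by
  have : CharP (Module.End k (FreeAlgebra k X)) p :=
    charP_of_injective_algebraMap (FaithfulSMul.algebraMap_injective k _) p
  rw [dGen, sub_pow_char_of_commute p (LinearMap.commute_mulLeft_right _ _),
    LinearMap.pow_mulLeft, LinearMap.pow_mulRight]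
  rfl

theorem powRel_commutator (hp : 2 < p) [CharP k p] [Fact p.Prime]
    (hi : ∀ x y : L, ⁅pOp x, y⁆ = (LieAlgebra.ad k L x ^ p) y) (i : X) (z : L) :
    powRel b p pOp i * lin b z - lin b z * powRel b p pOp i
      - (dGen k i ^ (p - 1)) (comRel b (b i) z) ∈ comSpan b (p + 1) := by
  obtain ⟨m, rfl⟩ : ∃ m, p = m + 1 := ⟨p - 1, by omega⟩
  have h := dGen_pow_sub_mem (b := b) i z m
  have h2 : comRel b (pOp (b i)) z ∈ comSpan b (m + 2) := by
    simpa using mem_comSpan (b := b) (n := m + 2) (u := []) (v := []) (by simp; omega) _ z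
  rw [dGen_pow_char, ← hi] at h
  convert sub_mem h h2 using 1
  rw [powRel, comRel_apply b (pOp (b i)), Nat.add_sub_cancel]
  generalize (dGen k i ^ m) (comRel b (b i) z) = d
  noncomm_ring

theorem dGen_pow_sub_right (i : X) (c : FreeAlgebra k X) (m : ℕ) :
    (dGen k i ^ m) c - (-1) ^ m * c * ι k i ^ m
      ∈ span k {x | ∃ r s, r + 1 + s = m ∧ x = ι k i ^ (r + 1) * c * ι k i ^ s} := by
  induction m with
  | zero => simp
  | succ m ih =>
    have h1 : dGen k i ((dGen k i ^ m) c - (-1) ^ m * c * ι k i ^ m) ∈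
        span k {x | ∃ r s, r + 1 + s = m + 1 ∧ x = ι k i ^ (r + 1) * c * ι k i ^ s} := by
      rw [← Submodule.mem_comap]
      refine (span_le.2 ?_ : span k _ ≤ _) ih
      rintro _ ⟨r, s, hrs, rfl⟩
      rw [SetLike.mem_coe, Submodule.mem_comap, dGen_apply]
      refine sub_mem (subset_span ⟨r + 1, s, by omega, ?_⟩)
        (subset_span ⟨r, s + 1, by omega, ?_⟩)
      · simp only [pow_succ' _ (r + 1), mul_assoc]
      · simp only [pow_succ, mul_assoc]
    have h2 : (-1) ^ m * (ι k i * c * ι k i ^ m) ∈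
        span k {x | ∃ r s, r + 1 + s = m + 1 ∧ x = ι k i ^ (r + 1) * c * ι k i ^ s} := by
      have : ι k i * c * ι k i ^ m ∈
        span k {x | ∃ r s, r + 1 + s = m + 1 ∧ x = ι k i ^ (r + 1) * c * ι k i ^ s} :=
        subset_span ⟨0, m, by omega, by simp⟩
      rcases neg_one_pow_eq_or (FreeAlgebra k X) m with h | h <;> rw [h] <;> simpa using this
    convert add_mem h1 h2 using 1
    rw [map_sub, pow_succ' _ m, Module.End.mul_apply, dGen_apply i (_ * _ * _)]
    rcases neg_one_pow_eq_or (FreeAlgebra k X) m with h | h <;> rw [pow_succ', pow_succ, h] <;>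
      noncomm_ring

theorem dGen_pow_sub_left (i : X) (c : FreeAlgebra k X) (m : ℕ) :
    (dGen k i ^ m) c - ι k i ^ m * c
      ∈ span k {x | ∃ r s, r + s + 1 = m ∧ x = ι k i ^ r * c * ι k i ^ (s + 1)} := by
  induction m with
  | zero => simp
  | succ m ih =>
    have h1 : dGen k i ((dGen k i ^ m) c - ι k i ^ m * c) ∈
        span k {x | ∃ r s, r + s + 1 = m + 1 ∧ x = ι k i ^ r * c * ι k i ^ (s + 1)} := by
      rw [← Submodule.mem_comap]
      refine (span_le.2 ?_ : span k _ ≤ _) ih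
      rintro _ ⟨r, s, hrs, rfl⟩
      rw [SetLike.mem_coe, Submodule.mem_comap, dGen_apply]
      refine sub_mem (subset_span ⟨r + 1, s, by omega, ?_⟩)
        (subset_span ⟨r, s + 1, by omega, ?_⟩)
      · simp only [pow_succ' _ r, mul_assoc]
      · simp only [pow_succ, mul_assoc]
    have h2 : ι k i ^ m * c * ι k i ∈
        span k {x | ∃ r s, r + s + 1 = m + 1 ∧ x = ι k i ^ r * c * ι k i ^ (s + 1)} :=
      subset_span ⟨m, 0, by omega, by simp⟩
    convert sub_mem h1 h2 using 1
    rw [map_sub, pow_succ' _ m, Module.End.mul_apply, dGen_apply i (_ * _), pow_succ']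
    noncomm_ring

variable [LinearOrder X] (b p pOp)

/-- The rewriting rules presenting the restricted enveloping algebra. -/
inductive Rule : List X → FreeAlgebra k X → Prop
  | swap {i j : X} (h : i < j) : Rule [j, i] (ι k i * ι k j + lin b ⁅b j, b i⁆)
  | pow (i : X) : Rule (List.replicate p i) (lin b (pOp (b i)))

/-- The one-step reductions of words: applications of a rewriting rule to a subword. -/
inductive Reduction : List X → FreeAlgebra k X → Prop
  | mk (u : List X) {w : List X} {f : FreeAlgebra k X} (h : Rule b p pOp w f) (v : List X) :
      Reduction (u ++ w ++ v) (word k u * f * word k v)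

/-- The order on words by length, then lexicographically. -/
abbrev WordLT : List X → List X → Prop := List.Shortlex (· < ·)

/-- The span of the relations with leading word smaller than `w`. -/
def below (w : List X) : Submodule k (FreeAlgebra k X) :=
  span k {x | ∃ w' g, Reduction b p pOp w' g ∧ WordLT w' w ∧ x = word k w' - g}

variable {b p pOp}

theorem wordLT_context {v w : List X} (h : WordLT v w) (s t : List X) :
    WordLT (s ++ v ++ t) (s ++ w ++ t) := by
  rw [List.append_assoc, List.append_assoc]
  refine List.Shortlex.append_left ?_ s
  rcases List.shortlex_def.1 h with h | ⟨hl, h⟩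
  · exact .of_length_lt (by simpa using h)
  · refine .of_lex (by simpa using hl) ?_
    clear * - h hl
    induction h with
    | nil => simp at hl
    | rel h => exact .rel h
    | cons _ ih => exact .cons (ih (by simpa using hl))

theorem rule_mem_below {r : List X} {f : FreeAlgebra k X} (h : Rule b p pOp r f)
    {u v w : List X} (hlt : WordLT (u ++ r ++ v) w) :
    word k u * (word k r - f) * word k v ∈ below b p pOp w :=
  subset_span ⟨_, _, .mk u h v, hlt, by simp [mul_sub, sub_mul, mul_assoc]⟩

theorem below_context {w : List X} {x : FreeAlgebra k X} (hx : x ∈ below b p pOp w)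
    (s t : List X) : word k s * x * word k t ∈ below b p pOp (s ++ w ++ t) := by
  induction hx using span_induction with
  | mem x h =>
    obtain ⟨w', g, ⟨u, h, v⟩, hlt, rfl⟩ := h
    have := rule_mem_below h (u := s ++ u) (v := v ++ t) (w := s ++ w ++ t)
      (by simpa using wordLT_context hlt s t)
    convert this using 1
    simp only [word_append]
    noncomm_ring
  | zero => simp
  | add x y _ _ hx hy => simpa [mul_add, add_mul] using add_mem hx hy
  | smul c x _ hx => simpa using smul_mem _ c hx

theorem comRel_basis_mem_below {i j : X} {u v w : List X} (h : WordLT (u ++ [i, j] ++ v) w)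
    (h' : WordLT (u ++ [j, i] ++ v) w) :
    word k u * comRel b (b i) (b j) * word k v ∈ below b p pOp w := by
  have key {i j : X} (hij : i < j) (h : WordLT (u ++ [j, i] ++ v) w) :
      word k u * comRel b (b j) (b i) * word k v ∈ below b p pOp w := by
    have := rule_mem_below (.swap (b := b) (p := p) (pOp := pOp) hij) h
    convert this using 3
    simp [comRel_apply]
    abel
  rcases lt_trichotomy i j with hij | rfl | hij
  · rw [comRel_swap]
    simpa using key hij h'
  · simp [comRel_apply]
  · exact key hij h

theorem comSpan_le_below (w : List X) : comSpan b w.length ≤ below b p pOp w := by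
  rw [comSpan, span_le]
  rintro _ ⟨u, v, y, z, hl, rfl⟩
  have hlt (i j : X) : WordLT (u ++ [i, j] ++ v) w := .of_length_lt (by simp; omega)
  let F : L →ₗ[k] L →ₗ[k] FreeAlgebra k X :=
    (comRel b).compr₂ (LinearMap.mulRight k (word k v) ∘ₗ LinearMap.mulLeft k (word k u))
  change F y z ∈ below b p pOp w
  induction b.mem_span y using span_induction with
  | zero => simp
  | add x y _ _ hx hy => simpa using add_mem hx hy
  | smul c x _ hx => simpa using smul_mem _ c hx
  | mem x h =>
    obtain ⟨i, rfl⟩ := h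
    induction b.mem_span z using span_induction with
    | zero => simp
    | add x y _ _ hx hy => simpa using add_mem hx hy
    | smul c x _ hx => simpa using smul_mem _ c hx
    | mem x h =>
      obtain ⟨j, rfl⟩ := h
      exact comRel_basis_mem_below (hlt i j) (hlt j i)

theorem mem_below_of_length {w u v : List X} (h : u.length + 2 + v.length < w.length) (y z : L) :
    word k u * comRel b y z * word k v ∈ below b p pOp w :=
  comSpan_le_below w (mem_comSpan h y z)

theorem swap_swap_confluent {i j l : X} (hij : i < j) (hjl : j < l) :
    (ι k j * ι k l + lin b ⁅b l, b j⁆) * ι k i - ι k l * (ι k i * ι k j + lin b ⁅b j, b i⁆)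
      ∈ below b p pOp [l, j, i] := by
  have hil := hij.trans hjl
  have e1 : ι k j * comRel b (b l) (b i) ∈ below b p pOp [l, j, i] := by
    have := comRel_basis_mem_below (b := b) (p := p) (pOp := pOp) (i := l) (j := i) (u := [j])
      (v := []) (w := [l, j, i]) (.of_lex rfl (.rel hjl)) (.of_lex rfl (.rel hjl))
    simpa using this
  have e2 : comRel b (b j) (b i) * ι k l ∈ below b p pOp [l, j, i] := by
    have := comRel_basis_mem_below (b := b) (p := p) (pOp := pOp) (i := j) (j := i) (u := [])
      (v := [l]) (w := [l, j, i]) (.of_lex rfl (.rel hjl)) (.of_lex rfl (.rel hil))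
    simpa using this
  have e3 : comRel b (b l) (b i) * ι k j ∈ below b p pOp [l, j, i] := by
    have := comRel_basis_mem_below (b := b) (p := p) (pOp := pOp) (i := l) (j := i) (u := [])
      (v := [j]) (w := [l, j, i]) (.of_lex rfl (.cons (.rel hij))) (.of_lex rfl (.rel hil))
    simpa using this
  have e4 : ι k i * comRel b (b l) (b j) ∈ below b p pOp [l, j, i] := by
    have := comRel_basis_mem_below (b := b) (p := p) (pOp := pOp) (i := l) (j := j) (u := [i])
      (v := []) (w := [l, j, i]) (.of_lex rfl (.rel hil)) (.of_lex rfl (.rel hil))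
    simpa using this
  have hc (y z : L) : comRel b y z ∈ below b p pOp [l, j, i] := by
    simpa using mem_below_of_length (b := b) (p := p) (pOp := pOp) (w := [l, j, i]) (u := [])
      (v := []) (by simp) y z
  have jac : lin b ⁅⁅b j, b i⁆, b l⁆ + lin b ⁅b j, ⁅b l, b i⁆⁆ + lin b ⁅⁅b l, b j⁆, b i⁆ = 0 := by
    rw [← map_add, ← map_add, lie_lie (b l), ← lie_skew ⁅b j, b i⁆ (b l)]
    convert map_zero (lin b)
    abel
  have := add_mem (add_mem (add_mem (sub_mem (sub_mem (add_mem e1 e2) e3) e4)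
    (hc ⁅b j, b i⁆ (b l))) (hc (b j) ⁅b l, b i⁆)) (hc ⁅b l, b j⁆ (b i))
  convert this using 1
  rw [← sub_eq_zero, ← jac]
  simp only [comRel_apply, lin_basis]
  noncomm_ring

theorem swap_pow_confluent (hp : 2 < p) [CharP k p] [Fact p.Prime]
    (hi : ∀ x y : L, ⁅pOp x, y⁆ = (LieAlgebra.ad k L x ^ p) y) {i j : X} (hij : i < j) :
    (ι k i * ι k j + lin b ⁅b j, b i⁆) * ι k i ^ (p - 1) - ι k j * lin b (pOp (b i))
      ∈ below b p pOp (j :: List.replicate p i) := by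
  have h1 := comSpan_le_below (p := p) (pOp := pOp) (j :: List.replicate p i)
    (by simpa using powRel_commutator (b := b) hp hi i (b j))
  have h2 : powRel b p pOp i * ι k j ∈ below b p pOp (j :: List.replicate p i) := by
    have := rule_mem_below (u := []) (v := [j]) (.pow i : Rule b p pOp _ _)
      (w := j :: List.replicate p i) (.of_lex (by simp) (by
        obtain ⟨m, rfl⟩ : ∃ m, p = m + 1 := ⟨p - 1, by omega⟩
        exact .rel hij))
    simpa [powRel] using this
  have h3 : (dGen k i ^ (p - 1)) (comRel b (b i) (b j))
      - (-1) ^ (p - 1) * comRel b (b i) (b j) * ι k i ^ (p - 1)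
        ∈ below b p pOp (j :: List.replicate p i) := by
    refine span_le.2 ?_ (dGen_pow_sub_right i _ (p - 1))
    rintro _ ⟨r, s, hrs, rfl⟩
    have := comRel_basis_mem_below (b := b) (p := p) (pOp := pOp) (i := i) (j := j)
      (u := List.replicate (r + 1) i) (v := List.replicate s i) (w := j :: List.replicate p i)
      (.of_lex (by simp; omega) (.rel hij)) (.of_lex (by simp; omega) (.rel hij))
    simpa using this
  have heven : Even (p - 1) := (Fact.out : p.Prime).even_sub_one (by omega)
  rw [heven.neg_one_pow, one_mul] at h3
  convert sub_mem (sub_mem h2 h1) h3 using 1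
  obtain ⟨m, rfl⟩ : ∃ m, p = m + 1 := ⟨p - 1, by omega⟩
  generalize (dGen k i ^ (m + 1 - 1)) (comRel b (b i) (b j)) = d
  rw [comRel_apply, powRel, ← lie_skew, map_neg]
  simp only [lin_basis, Nat.add_sub_cancel, pow_succ']
  noncomm_ring

theorem pow_swap_confluent (hp : 2 < p) [CharP k p] [Fact p.Prime]
    (hi : ∀ x y : L, ⁅pOp x, y⁆ = (LieAlgebra.ad k L x ^ p) y) {i j : X} (hij : i < j) :
    lin b (pOp (b j)) * ι k i - ι k j ^ (p - 1) * (ι k i * ι k j + lin b ⁅b j, b i⁆)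
      ∈ below b p pOp (List.replicate p j ++ [i]) := by
  have h1 := comSpan_le_below (p := p) (pOp := pOp) (List.replicate p j ++ [i])
    (by simpa using powRel_commutator (b := b) hp hi j (b i))
  obtain ⟨m, rfl⟩ : ∃ m, p = m + 1 := ⟨p - 1, by omega⟩
  have h2 : ι k i * powRel b (m + 1) pOp j ∈
      below b (m + 1) pOp (List.replicate (m + 1) j ++ [i]) := by
    have := rule_mem_below (u := [i]) (v := []) (.pow j : Rule b (m + 1) pOp _ _)
      (w := List.replicate (m + 1) j ++ [i]) (.of_lex (by simp) (.rel hij))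
    simpa [powRel] using this
  have h3 : (dGen k j ^ m) (comRel b (b j) (b i)) - ι k j ^ m * comRel b (b j) (b i)
        ∈ below b (m + 1) pOp (List.replicate (m + 1) j ++ [i]) := by
    refine span_le.2 ?_ (dGen_pow_sub_left j _ m)
    rintro _ ⟨r, s, hrs, rfl⟩
    have hw : List.replicate (m + 1) j ++ [i] =
        List.replicate r j ++ ([j, j] ++ List.replicate s j ++ [i]) := by
      rw [show m + 1 = r + (s + 1 + 1) by omega, List.replicate_add, List.replicate_succ,
        List.replicate_succ]
      simp
    have := comRel_basis_mem_below (b := b) (p := m + 1) (pOp := pOp) (i := j) (j := i)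
      (u := List.replicate r j) (v := List.replicate (s + 1) j)
      (w := List.replicate (m + 1) j ++ [i]) ?_ ?_
    · simpa using this
    all_goals
      rw [hw, List.append_assoc]
      refine List.Shortlex.append_left (.of_lex (by simp) ?_) _
    · exact .cons (.rel hij)
    · exact .rel hij
  convert neg_mem (add_mem (add_mem h1 h2) h3) using 1
  rw [Nat.add_sub_cancel]
  generalize (dGen k j ^ m) (comRel b (b j) (b i)) = d
  rw [comRel_apply, powRel]
  simp only [lin_basis, pow_succ]
  noncomm_ring

theorem pow_pow_confluent (hp : 2 < p) [CharP k p] [Fact p.Prime]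
    (hi : ∀ x y : L, ⁅pOp x, y⁆ = (LieAlgebra.ad k L x ^ p) y) (i : X) (m : ℕ) :
    lin b (pOp (b i)) * ι k i ^ m - ι k i ^ m * lin b (pOp (b i))
      ∈ below b p pOp (List.replicate (p + m) i) := by
  have hz : ⁅pOp (b i), b i⁆ = 0 := by
    obtain ⟨m, rfl⟩ : ∃ m, p = m + 1 := ⟨p - 1, by omega⟩
    rw [hi, pow_succ, Module.End.mul_apply, LieAlgebra.ad_apply, lie_self, map_zero]
  have key (m : ℕ) : lin b (pOp (b i)) * ι k i ^ m - ι k i ^ m * lin b (pOp (b i))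
      ∈ comSpan b (m + 2) := by
    induction m with
    | zero => simp
    | succ m ih =>
      have h1 := mul_ι_mem_comSpan i ih
      have h2 := mem_comSpan (b := b) (n := m + 3) (u := List.replicate m i) (v := [])
        (by simp) (pOp (b i)) (b i)
      convert add_mem h1 h2 using 1
      simp only [word_replicate, word_nil, comRel_apply, lin_basis, hz, map_zero, pow_succ]
      noncomm_ring
  exact comSpan_le_below _ (comSpan_mono (by simp; omega) (key m))

end RestrictedPBW

namespace RestrictedPBW
variable {k : Type*} [Field k] {X : Type*} {L : Type*} [LieRing L] [LieAlgebra k L]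
variable {b : Module.Basis X k L} {p : ℕ} {pOp : L → L} [LinearOrder X]

theorem rule_mem_span {r : List X} {f : FreeAlgebra k X} (hp : 2 < p) (h : Rule b p pOp r f) :
    f ∈ span k (word k '' {w' | WordLT w' r}) := by
  have hlin {r : List X} (hr : 1 < r.length) (x : L) :
      lin b x ∈ span k (word k '' {w' | WordLT w' r}) := by
    induction b.mem_span x using span_induction with
    | zero => simp
    | add x y _ _ hx hy => simpa using add_mem hx hy
    | smul c x _ hx => simpa using smul_mem _ c hx
    | mem x h =>
      obtain ⟨i, rfl⟩ := h
      exact subset_span ⟨[i], .of_length_lt (by simpa using hr), by simp⟩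
  cases h with
  | @swap i j hij =>
    exact add_mem (subset_span ⟨[i, j], .of_lex rfl (.rel hij), by simp⟩) (hlin (by simp) _)
  | pow i => exact hlin (by simp; omega) _

theorem confluent_disjoint (hp : 2 < p) {r r' : List X}
    {f f' : FreeAlgebra k X} (h : Rule b p pOp r f) (h' : Rule b p pOp r' f') (m v : List X) :
    f * word k (m ++ r' ++ v) - word k (r ++ m) * f' * word k v
      ∈ below b p pOp (r ++ m ++ r' ++ v) := by
  have h1 : f * word k m * (word k r' - f') * word k v ∈ below b p pOp (r ++ m ++ r' ++ v) := by
    have hf := rule_mem_span hp h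
    clear h
    induction hf using span_induction with
    | zero => simp
    | add x y _ _ hx hy => simpa [add_mul] using add_mem hx hy
    | smul c x _ hx => simpa using smul_mem _ c hx
    | mem x hx =>
      obtain ⟨w', hw', rfl⟩ := hx
      simpa using rule_mem_below h' (u := w' ++ m) (v := v) (w := r ++ m ++ r' ++ v)
        (by simpa using wordLT_context hw' [] (m ++ r' ++ v))
  have h2 : (word k r - f) * word k m * f' * word k v ∈ below b p pOp (r ++ m ++ r' ++ v) := by
    have hf := rule_mem_span hp h'
    clear h1 h'
    induction hf using span_induction with
    | zero => simp
    | add x y _ _ hx hy => simpa [mul_add, add_mul] using add_mem hx hy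
    | smul c x _ hx => simpa using smul_mem _ c hx
    | mem x hx =>
      obtain ⟨w', hw', rfl⟩ := hx
      simpa [mul_assoc] using rule_mem_below h (u := []) (v := m ++ w' ++ v)
        (w := r ++ m ++ r' ++ v) (by simpa using wordLT_context hw' (r ++ m) v)
  convert sub_mem h1 h2 using 1
  simp only [word_append]
  noncomm_ring

theorem confluent_append (hp : 2 < p) [CharP k p] [Fact p.Prime]
    (hi : ∀ x y : L, ⁅pOp x, y⁆ = (LieAlgebra.ad k L x ^ p) y) {r r' : List X}
    {f f' : FreeAlgebra k X} (h : Rule b p pOp r f) (h' : Rule b p pOp r' f')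
    {m v v' : List X} (heq : r ++ v = m ++ r' ++ v') :
    f * word k v - word k m * f' * word k v' ∈ below b p pOp (r ++ v) := by
  rw [List.append_assoc] at heq
  rcases List.append_eq_append_iff.1 heq with ⟨m, rfl, rfl⟩ | ⟨o, hr, ho⟩
  · simpa using confluent_disjoint hp h h' m v'
  by_cases hnil : o = []
  · subst hnil
    obtain rfl : r = m := by simpa using hr
    obtain rfl : r' ++ v' = v := by simpa using ho
    simpa using confluent_disjoint hp h h' [] v'
  obtain ⟨q, rfl⟩ : ∃ q, p = q + 3 := ⟨p - 3, by omega⟩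
  cases h with
  | @swap i j hij =>
    rcases m with _ | ⟨j₁, m⟩
    · obtain rfl : [j, i] = o := by simpa using hr
      cases h' with
      | @swap i' j' hij' =>
        obtain ⟨rfl, rfl, rfl⟩ : j' = j ∧ i' = i ∧ v' = v := by simpa using ho
        simp
      | pow i' =>
        obtain ⟨rfl, rfl, -⟩ : i' = j ∧ i' = i ∧ _ := by simpa [List.replicate_succ] using ho
        exact absurd hij (lt_irrefl _)
    · rw [List.cons_append, List.cons.injEq] at hr
      obtain ⟨rfl, hr⟩ := hr
      obtain ⟨rfl, rfl⟩ : m = [] ∧ o = [i] := by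
        rcases m with _ | ⟨j₁, m⟩
        · simpa using hr.symm
        · rw [List.cons_append, List.cons.injEq] at hr
          exact absurd (List.append_eq_nil_iff.1 hr.2.symm).2 hnil
      cases h' with
      | @swap i' j' hij' =>
        obtain ⟨rfl, rfl⟩ : j' = i ∧ i' :: v' = v := by simpa using ho
        have := below_context (swap_swap_confluent (b := b) (p := q + 3) (pOp := pOp) hij' hij) [] v'
        simpa [mul_assoc, sub_mul] using this
      | pow i' =>
        obtain ⟨rfl, rfl⟩ : i' = i ∧ List.replicate (q + 2) i' ++ v' = v := by
          simpa [List.replicate_succ] using ho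
        have := below_context (swap_pow_confluent (b := b) (pOp := pOp) hp hi hij) [] v'
        simpa [mul_assoc, sub_mul, List.replicate_succ, pow_succ'] using this
  | pow i =>
    obtain ⟨hlen, hm, ho'⟩ := List.append_eq_replicate_iff.1 hr.symm
    generalize m.length = s at hlen hm
    generalize hol : o.length = t at hlen ho'
    subst hm ho'
    obtain ⟨t, rfl⟩ : ∃ t', t = t' + 1 := ⟨t - 1, by
      have : 0 < t := by rw [← hol]; exact List.length_pos_iff.2 hnil
      omega⟩
    cases h' with
    | @swap i' j' hij' =>
      obtain ⟨rfl, ho⟩ : j' = i ∧ i' :: v' = List.replicate t i ++ v := by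
        simpa [List.replicate_succ] using ho
      rcases t with _ | t
      · obtain rfl : i' :: v' = v := by simpa using ho
        obtain rfl : s = q + 2 := by omega
        have := below_context (pow_swap_confluent (b := b) (pOp := pOp) hp hi hij') [] v'
        simpa [mul_assoc, sub_mul] using this
      · obtain ⟨rfl, -⟩ : i' = j' ∧ _ := by simpa [List.replicate_succ] using ho
        exact absurd hij' (lt_irrefl _)
    | pow i' =>
      obtain rfl : i' = i := by
        have : i' = i ∧ List.replicate (q + 2) i' ++ v' = List.replicate t i ++ v := by
          simpa [List.replicate_succ] using ho
        exact this.1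
      obtain rfl : List.replicate s i' ++ v' = v := by
        rw [← hlen, add_comm, List.replicate_add, List.append_assoc] at ho
        exact List.append_cancel_left ho
      have := below_context (pow_pow_confluent (b := b) (pOp := pOp) hp hi i' s) [] v'
      simpa [mul_assoc, sub_mul, List.replicate_add] using this

theorem reduction_confluent (hp : 2 < p) [CharP k p] [Fact p.Prime]
    (hi : ∀ x y : L, ⁅pOp x, y⁆ = (LieAlgebra.ad k L x ^ p) y) {w : List X}
    {f f' : FreeAlgebra k X} (h : Reduction b p pOp w f) (h' : Reduction b p pOp w f') :
    f - f' ∈ below b p pOp w := by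
  obtain ⟨u, h, v⟩ := h
  rename_i r f
  generalize hw : u ++ r ++ v = w at h'
  obtain ⟨u', h', v'⟩ := h'
  rename_i r' f'
  simp only [List.append_assoc] at hw
  rcases List.append_eq_append_iff.1 hw with ⟨m, rfl, hm⟩ | ⟨m, rfl, hm⟩
  · have := below_context (confluent_append hp hi h h' (by simpa using hm)) u []
    convert this using 1
    · simp [hm]
    · simp [mul_sub, mul_assoc]
  · have := below_context (confluent_append hp hi h' h (by simpa using hm)) u' []
    convert neg_mem this using 1
    · simp [hm]
    · simp [mul_sub, mul_assoc]

theorem reduction_mem_span {w : List X} {f : FreeAlgebra k X} (hp : 2 < p)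
    (h : Reduction b p pOp w f) : f ∈ span k (word k '' {w' | WordLT w' w}) := by
  obtain ⟨u, h, v⟩ := h
  have hf := rule_mem_span hp h
  clear h
  induction hf using span_induction with
  | zero => simp
  | add x y _ _ hx hy => simpa [mul_add, add_mul] using add_mem hx hy
  | smul c x _ hx => simpa using smul_mem _ c hx
  | mem x h =>
    obtain ⟨w', hw', rfl⟩ := h
    exact subset_span ⟨_, wordLT_context hw' u v, by simp [mul_assoc]⟩

/-- The words indexing the PBW basis: weakly increasing with no letter repeated `p` times. -/
def IsNormal (p : ℕ) (w : List X) : Prop :=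
  w.Pairwise (· ≤ ·) ∧ ∀ i, w.count i < p

theorem IsNormal.not_reduction {w : List X} (hw : IsNormal p w) (f : FreeAlgebra k X) :
    ¬ Reduction b p pOp w f := by
  rintro ⟨u, h, v⟩
  cases h with
  | @swap i j hij =>
    have := hw.1
    simp only [List.pairwise_append, List.pairwise_cons] at this
    exact absurd (this.1.2.1.1 i (by simp)) hij.not_ge
  | pow i =>
    have := hw.2 i
    simp at this
    omega

theorem exists_normalForm_word (hp : 2 < p) [CharP k p] [Fact p.Prime] [WellFoundedLT X]
    (b : Module.Basis X k L)
    (hi : ∀ x y : L, ⁅pOp x, y⁆ = (LieAlgebra.ad k L x ^ p) y) :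
    ∃ N : FreeAlgebra k X →ₗ[k] FreeAlgebra k X, (∀ w, IsNormal p w → N (word k w) = word k w) ∧
      ∀ w f, Reduction b p pOp w f → N (word k w) = N f := by
  have hβ : ⇑(wordBasis k X) = word k := funext fun w => wordBasis_apply k w
  have := exists_normalForm (wordBasis k X) (List.Shortlex.wf (wellFounded_lt (α := X)))
    (Reduction b p pOp) (fun w f h => by rw [hβ]; exact reduction_mem_span hp h)
    (fun w f f' h h' => by rw [hβ]; exact reduction_confluent hp hi h h')
  rw [hβ] at this
  obtain ⟨N, h1, h2⟩ := this
  exact ⟨N, fun w hw => h1 w hw.not_reduction, h2⟩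

end RestrictedPBW

namespace RestrictedPBW

variable {k : Type*} [Field k] {X : Type*} {L : Type*} [LieRing L] [LieAlgebra k L]

/-- The monomial in the restricted enveloping algebra attached to a word in a family of elements. -/
def mon (k : Type*) [Field k] {X L : Type*} [LieRing L] [LieAlgebra k L] (p : ℕ) (pOp : L → L)
    (x : X → L) (w : List X) : RUEA k L p pOp :=
  (w.map fun i => rι k p pOp (x i)).prod

section

attribute [local instance] LieRing.ofAssociativeRing

section mon

variable (p : ℕ) (pOp : L → L) (x : X → L)

@[simp] theorem mon_nil : mon k p pOp x [] = 1 := rfl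

@[simp] theorem mon_cons (i : X) (w : List X) :
    mon k p pOp x (i :: w) = rι k p pOp (x i) * mon k p pOp x w := by
  simp [mon]

@[simp] theorem mon_append (v w : List X) :
    mon k p pOp x (v ++ w) = mon k p pOp x v * mon k p pOp x w := by
  simp [mon]

@[simp] theorem mon_replicate (m : ℕ) (i : X) :
    mon k p pOp x (List.replicate m i) = rι k p pOp (x i) ^ m := by
  simp [mon]

theorem mon_map {Y : Type*} (f : Y → X) (w : List Y) :
    mon k p pOp x (w.map f) = mon k p pOp (x ∘ f) w := by
  simp [mon, Function.comp_def]

variable (k) in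
/-- The linear map `𝔤 → U'(𝔤)`. -/
def rιₗ : L →ₗ[k] RUEA k L p pOp :=
  (RingQuot.mkAlgHom k (rRel k L p pOp)).toLinearMap ∘ₗ
    (UniversalEnvelopingAlgebra.ι k : L →ₗ⁅k⁆ UniversalEnvelopingAlgebra k L).toLinearMap

theorem rιₗ_apply (y : L) : rιₗ k p pOp y = rι k p pOp y := rfl

theorem rι_lie (y z : L) :
    rι k p pOp ⁅y, z⁆ = rι k p pOp y * rι k p pOp z - rι k p pOp z * rι k p pOp y := by
  simp [rι, LieHom.map_lie, LieRing.of_associative_ring_bracket]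

theorem rι_pow (y : L) : rι k p pOp y ^ p = rι k p pOp (pOp y) := by
  rw [rι, rι, ← map_pow]
  exact RingQuot.mkAlgHom_rel k ⟨y, rfl, rfl⟩

end mon

/-- Left multiplication on the quotient of an algebra by a left ideal. -/
def quotientMul {A : Type*} [Ring A] [Algebra k A] (K : Submodule k A)
    (hK : ∀ a, ∀ x ∈ K, a * x ∈ K) : A →ₐ[k] Module.End k (A ⧸ K) :=
  AlgHom.ofLinearMap
    { toFun := fun a => K.mapQ K (LinearMap.mulLeft k a) (hK a)
      map_add' := fun a c => by ext x; exact congrArg _ (add_mul a c x)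
      map_smul' := fun a c => by ext x; exact congrArg _ (smul_mul_assoc a c x) }
    (by ext x; exact congrArg _ (one_mul x))
    (fun a c => by ext x; exact congrArg _ (mul_assoc a c x))

section Normal

variable [LinearOrder X] (b : Module.Basis X k L) (p : ℕ) (pOp : L → L)

/-- The span of all relations between words; it is an ideal of the free algebra. -/
def relSpan : Submodule k (FreeAlgebra k X) :=
  span k {x | ∃ w f, Reduction b p pOp w f ∧ x = word k w - f}

variable {b p pOp}

theorem mul_mem_relSpan (c : FreeAlgebra k X) {x : FreeAlgebra k X} (hx : x ∈ relSpan b p pOp) :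
    c * x ∈ relSpan b p pOp := by
  induction mem_span_word k c using span_induction with
  | zero => simp
  | add c d _ _ hc hd => simpa [add_mul] using add_mem hc hd
  | smul a c _ hc => simpa using smul_mem _ a hc
  | mem c hc =>
    obtain ⟨s, rfl⟩ := hc
    induction hx using span_induction with
    | zero => simp
    | add c d _ _ hc hd => simpa [mul_add] using add_mem hc hd
    | smul a c _ hc => simpa using smul_mem _ a hc
    | mem x h =>
      obtain ⟨w, f, ⟨u, h, v⟩, rfl⟩ := h
      exact subset_span ⟨_, _, .mk (s ++ u) h v, by simp [mul_sub, mul_assoc]⟩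

theorem rule_mul_mem_relSpan {r : List X} {f : FreeAlgebra k X} (h : Rule b p pOp r f)
    (a : FreeAlgebra k X) : (word k r - f) * a ∈ relSpan b p pOp := by
  induction mem_span_word k a using span_induction with
  | zero => simp
  | add c d _ _ hc hd => simpa [mul_add] using add_mem hc hd
  | smul a c _ hc => simpa using smul_mem _ a hc
  | mem c hc =>
    obtain ⟨v, rfl⟩ := hc
    exact subset_span ⟨_, _, .mk [] h v, by simp [sub_mul]⟩

variable (b p pOp) in
/-- Left multiplication on the quotient of the free algebra by all relations. -/
def quotMul : FreeAlgebra k X →ₐ[k] Module.End k (FreeAlgebra k X ⧸ relSpan b p pOp) :=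
  quotientMul (relSpan b p pOp) fun c _ hx => mul_mem_relSpan c hx

theorem quotMul_rule {r : List X} {f : FreeAlgebra k X} (h : Rule b p pOp r f) :
    quotMul b p pOp (word k r - f) = 0 := by
  ext a
  exact (Submodule.Quotient.mk_eq_zero _).2 (rule_mul_mem_relSpan h a)

theorem quotMul_comRel (y z : L) : quotMul b p pOp (comRel b y z) = 0 := by
  have hlt (i j : X) (hij : i < j) : quotMul b p pOp (comRel b (b j) (b i)) = 0 := by
    have := quotMul_rule (Rule.swap (b := b) (p := p) (pOp := pOp) hij)
    rwa [show word k [j, i] - _ = comRel b (b j) (b i) by simp [comRel_apply]; abel] at this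
  suffices (comRel b).compr₂ (quotMul b p pOp).toLinearMap = 0 from
    LinearMap.congr_fun₂ this y z
  refine b.ext fun j => b.ext fun i => ?_
  change quotMul b p pOp (comRel b (b j) (b i)) = 0
  rcases lt_trichotomy i j with h | rfl | h
  · exact hlt i j h
  · simp [comRel_apply]
  · rw [comRel_swap, map_neg, hlt j i h, neg_zero]

variable (b p pOp) in
/-- The action of a Lie algebra on the quotient of the free algebra by all relations. -/
def quotAction : L →ₗ⁅k⁆ Module.End k (FreeAlgebra k X ⧸ relSpan b p pOp) where
  toLinearMap := (quotMul b p pOp).toLinearMap ∘ₗ lin b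
  map_lie' {y z} := by
    have := quotMul_comRel (b := b) (p := p) (pOp := pOp) y z
    rw [comRel_apply, map_sub, map_sub, map_mul, map_mul, sub_eq_zero] at this
    exact this.symm

theorem exists_coordinates (hp : 2 < p) [CharP k p] [Fact p.Prime] [WellFoundedLT X]
    (hi : ∀ x y : L, ⁅pOp x, y⁆ = (LieAlgebra.ad k L x ^ p) y)
    (hii : ∀ (c : k) (x : L), pOp (c • x) = c ^ p • pOp x)
    (hiii : ∀ x y : L,
      UniversalEnvelopingAlgebra.ι k (pOp (x + y)) - UniversalEnvelopingAlgebra.ι k (pOp x)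
          - UniversalEnvelopingAlgebra.ι k (pOp y)
        = UniversalEnvelopingAlgebra.ι k (x + y) ^ p - UniversalEnvelopingAlgebra.ι k x ^ p
          - UniversalEnvelopingAlgebra.ι k y ^ p) (b : Module.Basis X k L) :
    ∃ ν : RUEA k L p pOp →ₗ[k] FreeAlgebra k X,
      ∀ w, IsNormal p w → ν (mon k p pOp b w) = word k w := by
  obtain ⟨N, hN, hR⟩ := exists_normalForm_word hp b hi
  let Q := FreeAlgebra k X ⧸ relSpan b p pOp
  let θ : FreeAlgebra k X →ₐ[k] Module.End k Q := quotMul b p pOp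
  let F := UniversalEnvelopingAlgebra.lift k (quotAction b p pOp)
  have hF (y : L) : F (UniversalEnvelopingAlgebra.ι k y) = θ (lin b y) :=
    UniversalEnvelopingAlgebra.lift_ι_apply k (quotAction b p pOp) y
  let E : Submodule k L :=
    { carrier := {y | F (UniversalEnvelopingAlgebra.ι k y ^ p) =
        F (UniversalEnvelopingAlgebra.ι k (pOp y))}
      zero_mem' := by
        have h0 : pOp 0 = 0 := by simpa [show p ≠ 0 by omega] using hii 0 0
        simp [h0, show p ≠ 0 by omega]
      add_mem' := fun {y z} hy hz => by
        have := congrArg F (hiii y z)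
        simp only [map_sub] at this
        change F _ = F _ at hy hz
        rw [hy, hz] at this
        exact (sub_left_inj.1 (sub_left_inj.1 this)).symm
      smul_mem' := fun c y hy => by
        change F _ = F _ at hy ⊢
        rw [hii, map_smul, map_smul, smul_pow, map_smul, map_smul, hy] }
  have hE (y : L) : y ∈ E := by
    have : span k (Set.range b) ≤ E := by
      rw [span_le]
      rintro _ ⟨i, rfl⟩
      have := quotMul_rule (Rule.pow (b := b) (p := p) (pOp := pOp) i)
      rw [map_sub, sub_eq_zero] at this
      change F _ = F _
      rw [map_pow, hF, hF, lin_basis, ← map_pow]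
      simpa using this
    rw [b.span_eq] at this
    exact this trivial
  let G : RUEA k L p pOp →ₐ[k] Module.End k Q := RingQuot.liftAlgHom k ⟨F, by
    rintro _ _ ⟨y, rfl, rfl⟩
    exact hE y⟩
  have hG (y : L) : G (rι k p pOp y) = θ (lin b y) := by
    rw [← hF]
    exact RingQuot.liftAlgHom_mkAlgHom_apply k F _ _
  have hmon (w : List X) : G (mon k p pOp b w) (Submodule.Quotient.mk 1) =
      Submodule.Quotient.mk (word k w) := by
    have : G (mon k p pOp b w) = θ (word k w) := by
      induction w with
      | nil => simp
      | cons i w ih => simp [hG, ih]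
    rw [this]
    change Submodule.Quotient.mk (word k w * 1) = _
    rw [mul_one]
  have hker : relSpan b p pOp ≤ LinearMap.ker N := by
    rw [relSpan, span_le]
    rintro _ ⟨w, f, h, rfl⟩
    simp [hR w f h]
  refine ⟨(relSpan b p pOp).liftQ N hker ∘ₗ
    LinearMap.applyₗ (Submodule.Quotient.mk 1 : Q) ∘ₗ G.toLinearMap, fun w hw => ?_⟩
  rw [← hN w hw]
  exact congrArg ((relSpan b p pOp).liftQ N hker) (hmon w)

end Normal

end

end RestrictedPBW

namespace RestrictedPBW

variable {k : Type*} [Field k] {X : Type*} {L : Type*} [LieRing L] [LieAlgebra k L]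

section words

variable [LinearOrder X]

theorem exists_descent {w : List X} (hw : ¬ w.Pairwise (· ≤ ·)) :
    ∃ u i j v, i < j ∧ w = u ++ [j, i] ++ v := by
  rw [← List.isChain_iff_pairwise] at hw
  induction w with
  | nil => simp at hw
  | cons a w ih =>
    cases w with
    | nil => simp at hw
    | cons c w =>
      by_cases hac : a ≤ c
      · obtain ⟨u, i, j, v, hij, h⟩ := ih (by simpa [hac] using hw)
        exact ⟨a :: u, i, j, v, hij, by simp [h]⟩
      · exact ⟨[], c, a, w, not_le.1 hac, rfl⟩

theorem replicate_isPrefix_of_pairwise {w : List X} (hw : w.Pairwise (· ≤ ·)) {i : X}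
    (h : ∀ j ∈ w, i ≤ j) : List.replicate (w.count i) i <+: w := by
  induction w with
  | nil => simp
  | cons a w ih =>
    rw [List.pairwise_cons] at hw
    by_cases ha : a = i
    · subst ha
      rw [List.count_cons_self, List.replicate_succ, List.prefix_cons_inj]
      exact ih hw.2 hw.1
    · have : (a :: w).count i = 0 := by
        refine List.count_eq_zero.2 fun hi => ?_
        rcases List.mem_cons.1 hi with rfl | hi
        · exact ha rfl
        · exact ha (le_antisymm (hw.1 i hi) (h a (by simp)))
      simp [this]

theorem replicate_isInfix_of_pairwise {w : List X} (hw : w.Pairwise (· ≤ ·)) (i : X) :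
    List.replicate (w.count i) i <:+: w := by
  induction w with
  | nil => simp
  | cons a w ih =>
    by_cases ha : a = i
    · subst ha
      exact (replicate_isPrefix_of_pairwise hw (by simpa using (List.pairwise_cons.1 hw).1)).isInfix
    · rw [List.count_cons_of_ne ha]
      exact (ih (List.pairwise_cons.1 hw).2).trans (List.suffix_cons a w).isInfix

theorem exists_reducible {p : ℕ} {w : List X} (hw : ¬ IsNormal p w) :
    (∃ u i j v, i < j ∧ w = u ++ [j, i] ++ v) ∨ ∃ u i v, w = u ++ List.replicate p i ++ v := by
  by_cases hs : w.Pairwise (· ≤ ·)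
  · right
    have : ∃ i, p ≤ w.count i := by simpa [IsNormal, hs] using hw
    obtain ⟨i, hi⟩ := this
    obtain ⟨u, v, h⟩ := replicate_isInfix_of_pairwise hs i
    refine ⟨u, i, List.replicate (w.count i - p) i ++ v, ?_⟩
    rw [List.append_assoc, ← List.append_assoc (List.replicate p i), ← List.replicate_add,
      Nat.add_sub_cancel' hi, ← List.append_assoc, h]
  · exact .inl (exists_descent hs)

end words

variable {p : ℕ} {pOp : L → L} {x : X → L}

section

attribute [local instance] LieRing.ofAssociativeRing

theorem subalgebra_eq_top {S : Subalgebra k (RUEA k L p pOp)} (h : ∀ y, rι k p pOp y ∈ S) :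
    S = ⊤ := by
  let T := S.comap (RingQuot.mkAlgHom k (rRel k L p pOp))
  let j : L →ₗ⁅k⁆ T :=
    { toFun := fun y => ⟨UniversalEnvelopingAlgebra.ι k y, h y⟩
      map_add' := fun y z => Subtype.ext (map_add _ y z)
      map_smul' := fun c y => Subtype.ext (map_smul _ c y)
      map_lie' := fun {y z} => Subtype.ext (LieHom.map_lie _ y z) }
  have hid : T.val.comp (UniversalEnvelopingAlgebra.lift k j) = AlgHom.id k _ := by
    ext y
    simp [j]
  rw [eq_top_iff]
  rintro y -
  obtain ⟨u, rfl⟩ := RingQuot.mkAlgHom_surjective k (rRel k L p pOp) y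
  have hu : T.val (UniversalEnvelopingAlgebra.lift k j u) = u := DFunLike.congr_fun hid u
  rw [← hu]
  exact (UniversalEnvelopingAlgebra.lift k j u).2

end

theorem range_mon_span (hx : span k (Set.range x) = ⊤) :
    span k (Set.range (mon k p pOp x)) = ⊤ := by
  let f : FreeAlgebra k X →ₐ[k] RUEA k L p pOp := FreeAlgebra.lift k fun i => rι k p pOp (x i)
  have hf (w : List X) : f (word k w) = mon k p pOp x w := by
    induction w with
    | nil => simp
    | cons i w ih => simp [f, ← ih]
  have h1 (y : L) : rι k p pOp y ∈ f.range := by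
    have : span k (Set.range x) ≤ (Subalgebra.toSubmodule f.range).comap (rιₗ k p pOp) := by
      rw [span_le]
      rintro _ ⟨i, rfl⟩
      exact ⟨ι k i, by simp [f, rιₗ_apply]⟩
    rw [hx] at this
    exact this (x := y) trivial
  rw [eq_top_iff]
  rintro y -
  have hy : y ∈ f.range := by
    rw [subalgebra_eq_top h1]
    trivial
  obtain ⟨a, rfl⟩ := hy
  have : map f.toLinearMap (span k (Set.range (word k))) ≤ span k (Set.range (mon k p pOp x)) := by
    rw [map_span_le]
    rintro _ ⟨w, rfl⟩
    exact subset_span ⟨w, (hf w).symm⟩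
  exact this ⟨a, mem_span_word k a, rfl⟩

variable (k p pOp x) in
/-- The filtration of the restricted enveloping algebra by monomials of weight less than `d`. -/
def filt (wt : X → ℕ) (d : ℕ) : Submodule k (RUEA k L p pOp) :=
  span k (mon k p pOp x '' {w | (w.map wt).sum < d})

variable {wt : X → ℕ}

theorem mon_mem_filt {w : List X} {d : ℕ} (h : (w.map wt).sum < d) :
    mon k p pOp x w ∈ filt k p pOp x wt d :=
  subset_span ⟨w, h, rfl⟩

theorem filt_mono {d d' : ℕ} (h : d ≤ d') : filt k p pOp x wt d ≤ filt k p pOp x wt d' :=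
  span_mono (Set.image_mono fun _ hw => lt_of_lt_of_le hw h)

theorem mul_mem_filt {d d' m : ℕ} (h : d + d' ≤ m + 1) {u v : RUEA k L p pOp}
    (hu : u ∈ filt k p pOp x wt d) (hv : v ∈ filt k p pOp x wt d') :
    u * v ∈ filt k p pOp x wt m := by
  induction hu using span_induction with
  | zero => simp
  | add a c _ _ ha hc => simpa [add_mul] using add_mem ha hc
  | smul a c _ hc => simpa using smul_mem _ a hc
  | mem u hu =>
    obtain ⟨u, hu, rfl⟩ := hu
    induction hv using span_induction with
    | zero => simp
    | add a c _ _ ha hc => simpa [mul_add] using add_mem ha hc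
    | smul a c _ hc => simpa using smul_mem _ a hc
    | mem v hv =>
      obtain ⟨v, hv, rfl⟩ := hv
      rw [← mon_append]
      rw [Set.mem_ofPred_eq] at hu hv
      exact mon_mem_filt (by simp; omega)

theorem rι_mem_filt {y : L} {d : ℕ} (hy : y ∈ span k (x '' {l | wt l < d})) :
    rι k p pOp y ∈ filt k p pOp x wt d := by
  rw [← rιₗ_apply, ← mem_comap]
  refine (span_le.2 ?_ : span k _ ≤ _) hy
  rintro _ ⟨l, hl, rfl⟩
  simpa [rιₗ_apply] using mon_mem_filt (k := k) (p := p) (pOp := pOp) (x := x) (w := [l])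
    (by simpa using hl)

theorem context_mem_span {S : Submodule k (RUEA k L p pOp)} {u v : List X} {s : Set X} {y : L}
    (hy : y ∈ span k (x '' s)) (h : ∀ l ∈ s, mon k p pOp x (u ++ [l] ++ v) ∈ S) :
    mon k p pOp x u * rι k p pOp y * mon k p pOp x v ∈ S := by
  have : span k (x '' s) ≤ S.comap (LinearMap.mulRight k (mon k p pOp x v) ∘ₗ
      LinearMap.mulLeft k (mon k p pOp x u) ∘ₗ rιₗ k p pOp) := by
    rw [span_le]
    rintro _ ⟨l, hl, rfl⟩
    simpa [rιₗ_apply, mul_assoc] using h l hl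
  exact this hy

theorem mon_mem_span_normal [LinearOrder X] [WellFoundedLT X] (hp : 2 ≤ p)
    (hbr : ∀ i j, ⁅x j, x i⁆ ∈ span k (x '' {l | wt l ≤ wt i + wt j}))
    (hpow : ∀ i, pOp (x i) ∈ span k (x '' {l | wt l ≤ p * wt i})) (w : List X) :
    mon k p pOp x w ∈
      span k (mon k p pOp x '' {w' | IsNormal p w' ∧ (w'.map wt).sum ≤ (w.map wt).sum}) := by
  induction w using (List.Shortlex.wf (wellFounded_lt (α := X))).induction with
  | _ w ih =>
  have key (w' : List X) (h : WordLT w' w) (hwt : (w'.map wt).sum ≤ (w.map wt).sum) :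
      mon k p pOp x w' ∈
        span k (mon k p pOp x '' {w' | IsNormal p w' ∧ (w'.map wt).sum ≤ (w.map wt).sum}) :=
    span_mono (Set.image_mono (by
      rintro v ⟨hv, hv'⟩
      exact ⟨hv, hv'.trans hwt⟩)) (ih w' h)
  by_cases hw : IsNormal p w
  · exact subset_span ⟨w, ⟨hw, le_rfl⟩, rfl⟩
  rcases exists_reducible hw with ⟨u, i, j, v, hij, rfl⟩ | ⟨u, i, v, rfl⟩
  · have h1 := key (u ++ [i, j] ++ v)
      (wordLT_context (v := [i, j]) (w := [j, i]) (.of_lex rfl (.rel hij)) u v) (by simp; omega)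
    have h2 := context_mem_span (u := u) (v := v) (hbr i j) fun l hl => key (u ++ [l] ++ v)
      (.of_length_lt (by simp)) (by simp at hl ⊢; omega)
    convert add_mem h1 h2 using 1
    simp only [mon_append, mon_cons, mon_nil, rι_lie]
    noncomm_ring
  · have := context_mem_span (u := u) (v := v) (hpow i) fun l hl => key (u ++ [l] ++ v)
      (.of_length_lt (by simp; omega)) (by simp at hl ⊢; omega)
    simpa [rι_pow, mul_assoc] using this

theorem filt_le_span_normal [LinearOrder X] [WellFoundedLT X] (hp : 2 ≤ p)
    (hbr : ∀ i j, ⁅x j, x i⁆ ∈ span k (x '' {l | wt l ≤ wt i + wt j}))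
    (hpow : ∀ i, pOp (x i) ∈ span k (x '' {l | wt l ≤ p * wt i})) (d : ℕ) :
    filt k p pOp x wt d ≤
      span k (mon k p pOp x '' {w | IsNormal p w ∧ (w.map wt).sum < d}) := by
  rw [filt, span_le]
  rintro _ ⟨w, hw, rfl⟩
  exact span_mono (Set.image_mono (by
      rintro v ⟨hv, hv'⟩
      exact ⟨hv, hv'.trans_lt hw⟩))
    (mon_mem_span_normal hp hbr hpow w)

end RestrictedPBW

namespace RestrictedPBW

section words

variable {A B : Type*} [LinearOrder A] [LinearOrder B] {p : ℕ}

/-- The word in a lexicographic sum obtained by concatenating words in the summands. -/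
def sumWord (u : List A) (v : List B) : List (A ⊕ₗ B) :=
  u.map (toLex ∘ Sum.inl) ++ v.map (toLex ∘ Sum.inr)

theorem exists_sumWord {w : List (A ⊕ₗ B)} (hw : w.Pairwise (· ≤ ·)) : ∃ u v, w = sumWord u v := by
  induction w with
  | nil => exact ⟨[], [], rfl⟩
  | cons a w ih =>
    rw [List.pairwise_cons] at hw
    obtain ⟨u, v, rfl⟩ := ih hw.2
    rcases a with a | a
    · exact ⟨a :: u, v, rfl⟩
    · rcases u with _ | ⟨c, u⟩
      · exact ⟨[], a :: v, rfl⟩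
      · exact absurd (hw.1 (toLex (Sum.inl c)) (by simp [sumWord])) (Sum.Lex.not_inr_le_inl)

theorem isNormal_sumWord {u : List A} {v : List B} :
    IsNormal p (sumWord u v) ↔ IsNormal p u ∧ IsNormal p v := by
  let _ : BEq (A ⊕ₗ B) := @instBEqOfDecidableEq _ LinearOrder.toDecidableEq
  have h1 : Function.Injective (toLex ∘ Sum.inl : A → A ⊕ₗ B) :=
    toLex.injective.comp Sum.inl_injective
  have h2 : Function.Injective (toLex ∘ Sum.inr : B → A ⊕ₗ B) :=
    toLex.injective.comp Sum.inr_injective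
  have hl (i : A) : (sumWord u v).count (toLex (Sum.inl i)) = u.count i := by
    rw [sumWord, List.count_append,
      show toLex (Sum.inl i) = (toLex ∘ Sum.inl : A → A ⊕ₗ B) i from rfl,
      List.count_map_of_injective _ _ h1, Nat.add_eq_left]
    exact List.count_eq_zero.2 (by simp)
  have hr (i : B) : (sumWord u v).count (toLex (Sum.inr i)) = v.count i := by
    rw [sumWord, List.count_append,
      show toLex (Sum.inr i) = (toLex ∘ Sum.inr : B → A ⊕ₗ B) i from rfl,
      List.count_map_of_injective _ _ h2, Nat.add_eq_right]
    exact List.count_eq_zero.2 (by simp)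
  have hc : (∀ i, (sumWord u v).count i < p) ↔ (∀ i, u.count i < p) ∧ ∀ i, v.count i < p := by
    constructor
    · exact fun h => ⟨fun i => hl i ▸ h _, fun i => hr i ▸ h _⟩
    · rintro ⟨h, h'⟩ (i | i)
      · exact (hl i).trans_lt (h i)
      · exact (hr i).trans_lt (h' i)
  rw [IsNormal, hc, IsNormal, IsNormal]
  simp only [sumWord, List.pairwise_append, List.pairwise_map, Function.comp_apply,
    Sum.Lex.inl_le_inl_iff, Sum.Lex.inr_le_inr_iff, List.mem_map]
  constructor
  · rintro ⟨⟨h1, h2, -⟩, h3, h4⟩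
    exact ⟨⟨h1, h3⟩, h2, h4⟩
  · rintro ⟨⟨h1, h3⟩, h2, h4⟩
    refine ⟨⟨h1, h2, ?_⟩, h3, h4⟩
    rintro _ ⟨i, -, rfl⟩ _ ⟨j, -, rfl⟩
    exact Sum.Lex.inl_le_inr _ _

variable {n : ℕ}

/-- The weakly increasing word with prescribed multiplicities. -/
def multWord (a : Fin n → Fin p) : List (Fin n) :=
  (List.finRange n).flatMap fun i => List.replicate (a i) i

theorem count_multWord (a : Fin n → Fin p) (i : Fin n) : (multWord a).count i = a i := by
  rw [multWord, List.count_flatMap]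
  simp only [Function.comp_def, List.count_replicate, beq_iff_eq]
  rw [← List.ofFn_eq_map, List.sum_ofFn]
  simp

theorem isNormal_multWord (a : Fin n → Fin p) : IsNormal p (multWord a) := by
  refine ⟨?_, fun i => by rw [count_multWord]; exact (a i).2⟩
  rw [multWord, List.pairwise_flatMap]
  refine ⟨fun i _ => List.pairwise_replicate.2 (by simp), ?_⟩
  refine (List.pairwise_lt_finRange n).imp fun {i j} hij => ?_
  intro x hx y hy
  rw [List.eq_of_mem_replicate hx, List.eq_of_mem_replicate hy]
  exact hij.le

theorem eq_multWord {w : List (Fin n)} (hw : IsNormal p w) :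
    w = multWord fun i => ⟨w.count i, hw.2 i⟩ := by
  refine List.Perm.eq_of_pairwise' hw.1 (isNormal_multWord _).1 (List.perm_iff_count.2 fun i => ?_)
  rw [count_multWord]

theorem length_eq_sum_count (w : List (Fin n)) : w.length = ∑ i, w.count i := by
  simpa using
    (Multiset.sum_count_eq_card (s := Finset.univ) (m := (w : Multiset (Fin n))) (by simp)).symm

theorem multWord_injective : Function.Injective (multWord : (Fin n → Fin p) → _) := fun a a' h => by
  ext i
  rw [← count_multWord a, h, count_multWord]

theorem length_multWord (a : Fin n → Fin p) : (multWord a).length = ∑ i, (a i : ℕ) := by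
  simp [length_eq_sum_count, count_multWord]

variable {k : Type*} [Field k] {L : Type*} [LieRing L] [LieAlgebra k L] (pOp : L → L)

theorem mon_multWord (e : Fin n → L) (a : Fin n → Fin p) :
    mon k p pOp e (multWord a) = eMonR k p pOp e a := by
  rw [multWord, eMonR]
  induction List.finRange n with
  | nil => simp
  | cons i l ih => simp [ih]

theorem mon_sumWord {A B : Type*} (x : A ⊕ₗ B → L) (u : List A) (v : List B) :
    mon k p pOp x (sumWord u v) =
      mon k p pOp (x ∘ toLex ∘ Sum.inl) u * mon k p pOp (x ∘ toLex ∘ Sum.inr) v := by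
  rw [sumWord, mon_append, mon_map, mon_map]

end words

end RestrictedPBW

namespace RestrictedPBW

theorem sumWord_inj {A B : Type*} {u u' : List A} {v v' : List B}
    (h : sumWord u v = sumWord u' v') : u = u' ∧ v = v' := by
  have h1 (u : List A) (v : List B) : (sumWord u v).filterMap (Sum.getLeft? ∘ ofLex) = u := by
    simp [sumWord, List.filterMap_map, Function.comp_def]
  have h2 (u : List A) (v : List B) : (sumWord u v).filterMap (Sum.getRight? ∘ ofLex) = v := by
    simp [sumWord, List.filterMap_map, Function.comp_def]
  exact ⟨by rw [← h1 u v, h, h1], by rw [← h2 u v, h, h2]⟩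

variable {k : Type*} [Field k] {L : Type*} [LieRing L] [LieAlgebra k L] {p : ℕ} {pOp : L → L}
  {H : LieSubalgebra k L} {pOpH : H → H} {n : ℕ} {e : Fin n → L} {J : Type*}

/-- The concatenation of a family in a Lie subalgebra and of another family. -/
def subFam (c : J → H) (e : Fin n → L) : J ⊕ₗ Fin n → L :=
  Sum.elim (fun j => (c j : L)) e ∘ ofLex

theorem exists_coset_repr
    (hsp : span k (Set.range fun i => Submodule.Quotient.mk (p := H.toSubmodule) (e i)) = ⊤)
    (y : L) : ∃ r : Fin n → k, ∃ h : H, y = ∑ i, r i • e i + h := by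
  have hy : Submodule.Quotient.mk (p := H.toSubmodule) y ∈
      span k (Set.range fun i => Submodule.Quotient.mk (p := H.toSubmodule) (e i)) := by
    rw [hsp]; trivial
  obtain ⟨r, hr⟩ := (mem_span_range_iff_exists_fun k).1 hy
  refine ⟨r, ⟨y - ∑ i, r i • e i, ?_⟩, by simp⟩
  have : Submodule.Quotient.mk (p := H.toSubmodule) (∑ i, r i • e i) =
      Submodule.Quotient.mk y := by
    rw [← hr]
    simp [← Submodule.mkQ_apply]
  exact (Submodule.Quotient.eq H.toSubmodule).1 this.symm

theorem coe_mem_span {c : J → H} (hc : span k (Set.range c) = ⊤) (h : H) :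
    (h : L) ∈ span k (Set.range fun j => (c j : L)) := by
  have : map H.toSubmodule.subtype (span k (Set.range c)) ≤
      span k (Set.range fun j => (c j : L)) := by
    rw [map_span_le]
    rintro _ ⟨j, rfl⟩
    exact subset_span ⟨j, rfl⟩
  rw [hc] at this
  exact this ⟨h, trivial, rfl⟩

theorem span_subFam {c : J → H} (hc : span k (Set.range c) = ⊤)
    (hsp : span k (Set.range fun i => Submodule.Quotient.mk (p := H.toSubmodule) (e i)) = ⊤) :
    span k (Set.range (subFam c e)) = ⊤ := by
  rw [eq_top_iff]
  rintro y -
  obtain ⟨r, h, rfl⟩ := exists_coset_repr hsp y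
  refine add_mem (sum_mem fun i _ => smul_mem _ _ (subset_span ⟨toLex (Sum.inr i), rfl⟩)) ?_
  refine span_mono ?_ (coe_mem_span hc h)
  rintro _ ⟨j, rfl⟩
  exact ⟨toLex (Sum.inl j), rfl⟩

theorem exists_basis_subFam (c : Module.Basis J k H)
    (hli : LinearIndependent k (fun i => Submodule.Quotient.mk (p := H.toSubmodule) (e i)))
    (hsp : span k (Set.range fun i => Submodule.Quotient.mk (p := H.toSubmodule) (e i)) = ⊤) :
    ∃ b : Module.Basis (J ⊕ₗ Fin n) k L, ⇑b = subFam c e := by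
  have h : LinearIndependent k (Sum.elim (fun j => (c j : L)) e) :=
    LinearIndependent.sumElim_of_quotient (M' := H.toSubmodule) c.linearIndependent e hli
  have h' : LinearIndependent k (subFam c e) := h.comp _ ofLex.injective
  exact ⟨.mk h' (span_subFam c.span_eq hsp).ge, Module.Basis.coe_mk _ _⟩

theorem map_mon {φ : RUEA k H p pOpH →ₐ[k] RUEA k L p pOp}
    (hφ : ∀ h : H, φ (rι k p pOpH h) = rι k p pOp (h : L)) (c : J → H) (m : List J) :
    φ (mon k p pOpH c m) = mon k p pOp (fun j => (c j : L)) m := by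
  induction m with
  | nil => simp
  | cons j m ih => simp [hφ, ih]

theorem mem_span_isNormal [LinearOrder J] [WellFoundedLT J] {x : J → L} (hp : 2 ≤ p)
    (hx : span k (Set.range x) = ⊤) (u : RUEA k L p pOp) :
    u ∈ span k (mon k p pOp x '' {w | IsNormal p w}) := by
  have hu : u ∈ span k (Set.range (mon k p pOp x)) := by
    rw [range_mon_span hx]; trivial
  refine (span_le.2 ?_ : span k _ ≤ _) hu
  rintro _ ⟨w, rfl⟩
  have := mon_mem_span_normal (k := k) (pOp := pOp) (x := x) (wt := 0) hp (by simp [hx])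
    (by simp [hx]) w
  exact span_mono (Set.image_mono fun _ h => h.1) this

/-- A free left module structure of `U'(𝔤)` over `U'(𝔥)`. -/
theorem exists_leftCoordinates [LinearOrder J] [WellFoundedLT J]
    (hp : 2 < p) [CharP k p] [Fact p.Prime]
    (hi : ∀ x y : L, ⁅pOp x, y⁆ = (LieAlgebra.ad k L x ^ p) y)
    (hii : ∀ (c : k) (x : L), pOp (c • x) = c ^ p • pOp x)
    (hiii : ∀ x y : L,
      UniversalEnvelopingAlgebra.ι k (pOp (x + y)) - UniversalEnvelopingAlgebra.ι k (pOp x)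
          - UniversalEnvelopingAlgebra.ι k (pOp y)
        = UniversalEnvelopingAlgebra.ι k (x + y) ^ p - UniversalEnvelopingAlgebra.ι k x ^ p
          - UniversalEnvelopingAlgebra.ι k y ^ p)
    {φ : RUEA k H p pOpH →ₐ[k] RUEA k L p pOp}
    (hφ : ∀ h : H, φ (rι k p pOpH h) = rι k p pOp (h : L)) (c : Module.Basis J k H)
    (hli : LinearIndependent k (fun i => Submodule.Quotient.mk (p := H.toSubmodule) (e i)))
    (hsp : span k (Set.range fun i => Submodule.Quotient.mk (p := H.toSubmodule) (e i)) = ⊤) :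
    ∃ π : (Fin n → Fin p) → RUEA k L p pOp →ₗ[k] RUEA k H p pOpH,
      ∀ a a' w, π a (φ w * eMonR k p pOp e a') = if a = a' then w else 0 := by
  have : WellFoundedLT (J ⊕ₗ Fin n) := ⟨Sum.lex_wf wellFounded_lt wellFounded_lt⟩
  obtain ⟨b, hb⟩ := exists_basis_subFam c hli hsp
  obtain ⟨ν, hν⟩ := exists_coordinates hp hi hii hiii b
  let W : List J × (Fin n → Fin p) → List (J ⊕ₗ Fin n) := fun m => sumWord m.1 (multWord m.2)
  have hW : W.Injective := fun m m' h =>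
    Prod.ext (sumWord_inj h).1 (multWord_injective (sumWord_inj h).2)
  let G (a : Fin n → Fin p) : List (J ⊕ₗ Fin n) → RUEA k H p pOpH :=
    Function.extend W (fun m => if a = m.2 then mon k p pOpH c m.1 else 0) 0
  refine ⟨fun a => (wordBasis k _).constr k (G a) ∘ₗ ν, fun a a' w => ?_⟩
  induction mem_span_isNormal (by omega) c.span_eq w using span_induction with
  | zero => simp
  | add x y _ _ hx hy => rw [map_add, add_mul, map_add, hx, hy]; split_ifs <;> simp
  | smul r x _ hx => rw [map_smul, smul_mul_assoc, map_smul, hx]; split_ifs <;> simp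
  | mem x hx =>
    obtain ⟨m, hm, rfl⟩ := hx
    have h1 : φ (mon k p pOpH c m) * eMonR k p pOp e a' = mon k p pOp b (W (m, a')) := by
      rw [hb, mon_sumWord, map_mon hφ, ← mon_multWord]
      rfl
    rw [h1, LinearMap.comp_apply, hν _ (isNormal_sumWord.2 ⟨hm, isNormal_multWord a'⟩),
      ← wordBasis_apply, Module.Basis.constr_basis]
    exact hW.extend_apply (fun m => if a = m.2 then mon k p pOpH c m.1 else 0) 0 (m, a')

section weight

/-- The weight of letters for which the subalgebra has weight zero. -/
def subWeight : J ⊕ₗ Fin n → ℕ := Sum.elim (fun _ => 0) (fun _ => 1) ∘ ofLex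

theorem sum_subWeight (m : List J) (v : List (Fin n)) :
    ((sumWord m v).map subWeight).sum = v.length := by
  simp [sumWord, subWeight, Function.comp_def]

variable {c : J → H} (hc : span k (Set.range c) = ⊤)
  (hsp : span k (Set.range fun i => Submodule.Quotient.mk (p := H.toSubmodule) (e i)) = ⊤)

include hc in
theorem coe_mem_span_subWeight (h : H) (d : ℕ) :
    (h : L) ∈ span k (subFam c e '' {l | subWeight l ≤ d}) := by
  refine span_mono ?_ (coe_mem_span hc h)
  rintro _ ⟨j, rfl⟩
  exact ⟨toLex (Sum.inl j), by simp [subWeight], rfl⟩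

include hc hsp in
theorem mem_span_subWeight (y : L) {d : ℕ} (hd : 1 ≤ d) :
    y ∈ span k (subFam c e '' {l | subWeight l ≤ d}) := by
  have : {l : J ⊕ₗ Fin n | subWeight l ≤ d} = Set.univ := by
    refine Set.eq_univ_of_forall ?_
    rintro (l | l)
    exacts [Nat.zero_le d, hd]
  rw [this, Set.image_univ, span_subFam hc hsp]
  trivial

variable (k p pOp) in
/-- The filtration of `U'(𝔤)` in which `U'(𝔥)` has degree zero: the span of the monomials with less
than `d` letters outside `𝔥`. -/
abbrev subFilt (c : J → H) (e : Fin n → L) (d : ℕ) : Submodule k (RUEA k L p pOp) :=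
  filt k p pOp (subFam c e) subWeight d

include hc in
theorem coe_mem_subFilt (h : H) {d : ℕ} (hd : 1 ≤ d) :
    rι k p pOp (h : L) ∈ subFilt k p pOp c e d :=
  filt_mono hd (rι_mem_filt (by simpa [Nat.lt_one_iff] using coe_mem_span_subWeight hc h 0))

include hc hsp in
theorem rι_mem_subFilt (y : L) {d : ℕ} (hd : 2 ≤ d) : rι k p pOp y ∈ subFilt k p pOp c e d :=
  filt_mono hd (rι_mem_filt (by
    simpa [Nat.lt_succ_iff] using mem_span_subWeight hc hsp y le_rfl))

theorem mon_mem_subFilt (v : List (Fin n)) {d : ℕ} (hd : v.length < d) :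
    mon k p pOp e v ∈ subFilt k p pOp c e d := by
  have := mon_mem_filt (k := k) (p := p) (pOp := pOp) (x := subFam c e) (wt := subWeight)
    (w := sumWord [] v) (d := d) (by rwa [sum_subWeight])
  rw [mon_sumWord, mon_nil, one_mul] at this
  exact this

include hc hsp in
theorem subFilt_le [LinearOrder J] [WellFoundedLT J] (hp : 2 ≤ p)
    (hpOpH : ∀ h : H, (pOpH h : L) = pOp (h : L))
    {φ : RUEA k H p pOpH →ₐ[k] RUEA k L p pOp}
    (hφ : ∀ h : H, φ (rι k p pOpH h) = rι k p pOp (h : L)) (d : ℕ) :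
    subFilt k p pOp c e d ≤
      span k {u | ∃ w a, ∑ i, (a i : ℕ) < d ∧ u = φ w * eMonR k p pOp e a} := by
  have : WellFoundedLT (J ⊕ₗ Fin n) := ⟨Sum.lex_wf wellFounded_lt wellFounded_lt⟩
  refine (filt_le_span_normal hp ?_ ?_ d).trans (span_le.2 ?_)
  · rintro (i | i) (j | j)
    · exact coe_mem_span_subWeight hc ⁅c j, c i⁆ _
    · exact mem_span_subWeight hc hsp _ (Nat.le_refl 1)
    · exact mem_span_subWeight hc hsp _ (Nat.le_refl 1)
    · exact mem_span_subWeight hc hsp _ (Nat.le_add_right 1 1)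
  · rintro (i | i)
    · have := coe_mem_span_subWeight (e := e) hc (pOpH (c i)) 0
      rw [hpOpH] at this
      exact this
    · exact mem_span_subWeight hc hsp _ (show 1 ≤ p * 1 by omega)
  · rintro _ ⟨w, ⟨hw, hd⟩, rfl⟩
    obtain ⟨m, v, rfl⟩ := exists_sumWord hw.1
    have hv := (isNormal_sumWord.1 hw).2
    rw [sum_subWeight, eq_multWord hv, length_multWord] at hd
    refine subset_span ⟨mon k p pOpH c m, _, hd, ?_⟩
    rw [mon_sumWord, map_mon hφ, ← mon_multWord, ← eq_multWord hv]
    rfl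

end weight

theorem right_span [LinearOrder J] [WellFoundedLT J] (hp : 2 ≤ p)
    {φ : RUEA k H p pOpH →ₐ[k] RUEA k L p pOp}
    (hφ : ∀ h : H, φ (rι k p pOpH h) = rι k p pOp (h : L)) {c : J → H}
    (hc : span k (Set.range c) = ⊤)
    (hsp : span k (Set.range fun i => Submodule.Quotient.mk (p := H.toSubmodule) (e i)) = ⊤) :
    span k {u | ∃ a w, u = eMonR k p pOp e a * φ w} = ⊤ := by
  have : WellFoundedLT (Fin n ⊕ₗ J) := ⟨Sum.lex_wf wellFounded_lt wellFounded_lt⟩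
  let x : Fin n ⊕ₗ J → L := subFam c e ∘ toLex ∘ Sum.swap ∘ ofLex
  have hx : span k (Set.range x) = ⊤ := by
    rw [← span_subFam hc hsp]
    congr 1
    exact (toLex.surjective.comp (Sum.swap_rightInverse.surjective.comp
      ofLex.surjective)).range_comp (subFam c e)
  rw [eq_top_iff]
  rintro u -
  refine (span_le.2 ?_ : span k _ ≤ _) (mem_span_isNormal hp hx u)
  rintro _ ⟨w, hw, rfl⟩
  obtain ⟨v, m, rfl⟩ := exists_sumWord hw.1
  have hv := (isNormal_sumWord.1 hw).1
  refine subset_span ⟨fun i => ⟨v.count i, hv.2 i⟩, mon k p pOpH c m, ?_⟩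
  rw [map_mon hφ, ← mon_multWord, ← eq_multWord hv, mon_sumWord]
  rfl

end RestrictedPBW

namespace RestrictedPBW

variable {k : Type*} [Field k] {L : Type*} [LieRing L] [LieAlgebra k L] {p : ℕ} {pOp : L → L}
  {H : LieSubalgebra k L} {n : ℕ} {e : Fin n → L} {J : Type*} {c : J → H}

section leadingTerms

variable (hc : span k (Set.range c) = ⊤)
  (hsp : span k (Set.range fun i => Submodule.Quotient.mk (p := H.toSubmodule) (e i)) = ⊤)

include hc hsp in
theorem mon_sub_mon_mem_of_perm {v w : List (Fin n)} (h : v.Perm w) {d : ℕ} (hd : v.length ≤ d) :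
    mon k p pOp e v - mon k p pOp e w ∈ subFilt k p pOp c e d := by
  induction h generalizing d with
  | nil => simp
  | cons i _ ih =>
    rw [List.length_cons] at hd
    rw [mon_cons, mon_cons, ← mul_sub]
    exact mul_mem_filt (by omega) (rι_mem_subFilt hc hsp _ le_rfl)
      (ih (Nat.le_sub_one_of_lt hd))
  | swap i j l =>
    simp only [List.length_cons] at hd
    have : mon k p pOp e (j :: i :: l) - mon k p pOp e (i :: j :: l) =
        rι k p pOp ⁅e j, e i⁆ * mon k p pOp e l := by
      rw [rι_lie]
      simp only [mon_cons]
      noncomm_ring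
    rw [this]
    exact mul_mem_filt (m := d) (d' := d - 1) (by omega) (rι_mem_subFilt hc hsp _ le_rfl)
      (mon_mem_subFilt _ (by omega))
  | trans h _ ih ih' =>
    have := add_mem (ih hd) (ih' (h.length_eq ▸ hd))
    rwa [sub_add_sub_cancel] at this

include hc hsp in
theorem mon_mem_subFilt_of_le_count (hp : 2 ≤ p) {w : List (Fin n)} {i : Fin n}
    (hi : p ≤ w.count i) {d : ℕ} (hd : w.length ≤ d) :
    mon k p pOp e w ∈ subFilt k p pOp c e d := by
  obtain ⟨r, hr⟩ := (List.replicate_sublist_iff.2 hi).exists_perm_append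
  have hl := hr.length_eq
  rw [List.length_append, List.length_replicate] at hl
  have := mon_sub_mon_mem_of_perm (p := p) (pOp := pOp) hc hsp hr hd
  refine (sub_mem_iff_left _ ?_).1 this
  rw [mon_append, mon_replicate, rι_pow]
  exact mul_mem_filt (d' := r.length + 1) (by omega) (rι_mem_subFilt hc hsp _ le_rfl)
    (mon_mem_subFilt _ (by omega))

include hc hsp in
theorem mon_mem_subFilt_of_count_ne (hp : 2 ≤ p) {w : List (Fin n)}
    (hw : w.length ≤ n * (p - 1)) {i : Fin n} (hi : w.count i ≠ p - 1) :
    mon k p pOp e w ∈ subFilt k p pOp c e (n * (p - 1)) := by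
  by_cases h : ∃ j, p ≤ w.count j
  · obtain ⟨j, hj⟩ := h
    exact mon_mem_subFilt_of_le_count hc hsp hp hj hw
  · push Not at h
    refine mon_mem_subFilt w ?_
    rw [length_eq_sum_count]
    calc ∑ j, w.count j < ∑ _j : Fin n, (p - 1) :=
          Finset.sum_lt_sum (fun j _ => Nat.le_sub_one_of_lt (h j))
            ⟨i, Finset.mem_univ _, lt_of_le_of_ne (Nat.le_sub_one_of_lt (h i)) hi⟩
      _ = n * (p - 1) := by simp

end leadingTerms

theorem exists_trad_eq
    (hli : LinearIndependent k (fun i => Submodule.Quotient.mk (p := H.toSubmodule) (e i)))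
    (hsp : span k (Set.range fun i => Submodule.Quotient.mk (p := H.toSubmodule) (e i)) = ⊤)
    (h : H) : ∃ A : Fin n → Fin n → k,
      (∀ i, ∃ h' : H, ⁅(h : L), e i⁆ = ∑ j, A j i • e j + h') ∧ trad H h = ∑ i, A i i := by
  let b := Module.Basis.mk hli hsp.ge
  have hb (i : Fin n) : b i = H.toSubmodule.mkQ (e i) := Module.Basis.mk_apply _ _ i
  refine ⟨fun j i => b.repr (adQuot H h (b i)) j, fun i => ?_, ?_⟩
  · have := b.sum_repr (adQuot H h (b i))
    simp only [hb, ← map_smul, ← map_sum] at this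
    have h' := (Submodule.Quotient.eq H.toSubmodule).1 this.symm
    refine ⟨⟨_, h'⟩, ?_⟩
    simp [hb]
  · rw [trad, LinearMap.trace_eq_matrix_trace k b, Matrix.trace]
    simp [LinearMap.toMatrix_apply]

theorem sum_map_multWord {M : Type*} [AddCommMonoid M] (a : Fin n → Fin p) (f : Fin n → M) :
    ((multWord a).map f).sum = ∑ i, (a i : ℕ) • f i := by
  rw [Finset.sum_list_map_count, ← Finset.sum_subset (Finset.subset_univ (multWord a).toFinset)]
  · simp [count_multWord]
  · intro i _ hi
    rw [← count_multWord a i, List.count_eq_zero_of_not_mem (by simpa using hi), zero_smul]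

variable (hc : span k (Set.range c) = ⊤)
  (hsp : span k (Set.range fun i => Submodule.Quotient.mk (p := H.toSubmodule) (e i)) = ⊤)

include hc hsp in
theorem commutator_mem_subFilt (hp : 2 ≤ p) {T : List (Fin n)} (hT : ∀ i, T.count i = p - 1)
    {h : H} {A : Fin n → Fin n → k}
    (hA : ∀ i, ∃ h' : H, ⁅(h : L), e i⁆ = ∑ j, A j i • e j + h') (u l : List (Fin n))
    (hl : (u ++ l).Perm T) :
    mon k p pOp e u * (mon k p pOp e l * rι k p pOp (h : L) - rι k p pOp (h : L) * mon k p pOp e l)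
      + (l.map fun i => A i i).sum • mon k p pOp e T ∈ subFilt k p pOp c e (n * (p - 1)) := by
  induction l generalizing u with
  | nil => simp
  | cons i l ih =>
    have hlen : (u ++ i :: l).length = n * (p - 1) := by
      rw [hl.length_eq, length_eq_sum_count]
      simp [hT]
    obtain ⟨h', hh'⟩ := hA i
    have key : mon k p pOp e u * rι k p pOp ⁅(h : L), e i⁆ * mon k p pOp e l
        - A i i • mon k p pOp e T ∈ subFilt k p pOp c e (n * (p - 1)) := by
      have e1 : mon k p pOp e u * rι k p pOp ⁅(h : L), e i⁆ * mon k p pOp e l =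
          ∑ j, A j i • mon k p pOp e (u ++ j :: l)
            + mon k p pOp e u * rι k p pOp (h' : L) * mon k p pOp e l := by
        rw [hh', ← rιₗ_apply, map_add, map_sum, mul_add, add_mul, Finset.mul_sum,
          Finset.sum_mul]
        simp [rιₗ_apply, mul_assoc]
      rw [e1, ← Finset.add_sum_erase _ _ (Finset.mem_univ i), add_assoc, add_sub_right_comm,
        ← smul_sub]
      refine add_mem (smul_mem _ _ (mon_sub_mon_mem_of_perm hc hsp hl hlen.le))
        (add_mem (sum_mem fun j hj => smul_mem _ _ ?_) ?_)
      · refine mon_mem_subFilt_of_count_ne hc hsp hp (i := i) ?_ ?_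
        · simpa using hlen.le
        · have := hl.count_eq i
          rw [hT, List.count_append, List.count_cons_self] at this
          rw [List.count_append, List.count_cons_of_ne (Finset.ne_of_mem_erase hj)]
          omega
      · rw [List.length_append, List.length_cons] at hlen
        exact mul_mem_filt (d := u.length + 1) (d' := l.length + 1) (by omega)
          (mul_mem_filt (d := u.length + 1) (d' := 1) le_rfl (mon_mem_subFilt _ (by omega))
            (coe_mem_subFilt hc h' le_rfl)) (mon_mem_subFilt _ (by omega))
    have ih := ih (u ++ [i]) (by simpa using hl)
    convert sub_mem ih key using 1
    rw [rι_lie, List.map_cons, List.sum_cons, add_smul, mon_append]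
    simp only [mon_cons, mon_nil]
    noncomm_ring

include hc in
theorem top_mul_sub_mem_subFilt [CharP k p] (hp : 2 ≤ p)
    (hli : LinearIndependent k (fun i => Submodule.Quotient.mk (p := H.toSubmodule) (e i)))
    (hsp : span k (Set.range fun i => Submodule.Quotient.mk (p := H.toSubmodule) (e i)) = ⊤)
    {t : Fin n → Fin p} (ht : ∀ i, (t i : ℕ) = p - 1) (h : H) :
    eMonR k p pOp e t * rι k p pOp (h : L) - rι k p pOp (h : L) * eMonR k p pOp e t
      - trad H h • eMonR k p pOp e t ∈ subFilt k p pOp c e (n * (p - 1)) := by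
  obtain ⟨A, hA, htr⟩ := exists_trad_eq hli hsp h
  have := commutator_mem_subFilt (pOp := pOp) hc hsp hp (T := multWord t)
    (fun i => by rw [count_multWord, ht]) hA [] (multWord t) (by simp)
  rw [sum_map_multWord, mon_multWord, mon_nil, one_mul] at this
  have hs : ∑ i, (t i : ℕ) • A i i = - trad H h := by
    simp only [ht, nsmul_eq_mul]
    rw [Nat.cast_sub (by omega), CharP.cast_eq_zero, htr]
    simp
  rwa [hs, neg_smul, ← sub_eq_add_neg] at this

end RestrictedPBW

namespace RestrictedPBW

theorem bijective_of_triangular {k ι V : Type*} [Field k] [Fintype ι] [DecidableEq ι]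
    [AddCommGroup V] [Module k V] (deg : ι → ℕ) {B : ι → ι → Module.End k V}
    (h1 : ∀ b, B b b = 1) (h0 : ∀ a b, a ≠ b → deg a ≤ deg b → B b a = 0) :
    Function.Bijective (LinearMap.pi fun b => ∑ a, B b a ∘ₗ LinearMap.proj a :
      (ι → V) →ₗ[k] (ι → V)) := by
  set T : Module.End k (ι → V) := LinearMap.pi fun b => ∑ a, B b a ∘ₗ LinearMap.proj a with hT
  have hTa (x : ι → V) (b : ι) : T x b = ∑ a, B b a (x a) := by simp [hT]
  have hN (m : ℕ) (x : ι → V) (b : ι) (hm : ∑ a, deg a < deg b + m) : ((T - 1) ^ m) x b = 0 := by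
    induction m generalizing b with
    | zero =>
      exact absurd (Finset.single_le_sum (f := deg) (fun _ _ => Nat.zero_le _)
        (Finset.mem_univ b)) (by omega)
    | succ m ih =>
      rw [pow_succ', Module.End.mul_apply, LinearMap.sub_apply, Pi.sub_apply, hTa,
        ← Finset.add_sum_erase _ _ (Finset.mem_univ b), h1, Module.End.one_apply,
        Module.End.one_apply, add_sub_cancel_left]
      refine Finset.sum_eq_zero fun a ha => ?_
      by_cases hd : deg a ≤ deg b
      · rw [h0 a b (Finset.ne_of_mem_erase ha) hd, LinearMap.zero_apply]
      · rw [ih a (by omega), map_zero]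
  have hnil : IsNilpotent (T - 1) :=
    ⟨∑ a, deg a + 1, LinearMap.ext fun x => funext fun b => hN _ x b (by omega)⟩
  have := hnil.isUnit_one_add
  rw [add_sub_cancel] at this
  exact (Module.End.isUnit_iff T).1 this

section Frobenius

variable {k S U V ι : Type*} [Field k] [Ring S] [Algebra k S] [Ring U] [Algebra k U]
  [AddCommGroup V] [Module k V] {φ : S →ₐ[k] U} {ρ ρt : S →ₐ[k] Module.End k V} {E : ι → U}

theorem eq_of_semilinear (hl : span k {u | ∃ w a, u = φ w * E a} = ⊤) {f g : U →ₗ[k] V}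
    (hf : ∀ w u, f (φ w * u) = ρ w (f u)) (hg : ∀ w u, g (φ w * u) = ρ w (g u))
    (h : ∀ a, f (E a) = g (E a)) : f = g := by
  refine LinearMap.ext_on hl ?_
  rintro _ ⟨w, a, rfl⟩
  rw [hf, hg, h]

/-- Pairing with a linear map to a subring, as a map from a tensor product to a space of
homomorphisms. -/
def frobeniusLift (π : U →ₗ[k] S) (ρ : S →ₐ[k] Module.End k V) : U ⊗[k] V →ₗ[k] (U →ₗ[k] V) :=
  TensorProduct.lift <| LinearMap.mk₂ k
    (fun u v => LinearMap.applyₗ v ∘ₗ ρ.toLinearMap ∘ₗ π ∘ₗ LinearMap.mulRight k u)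
    (fun _ _ _ => by ext; simp [mul_add]) (fun _ _ _ => by ext; simp)
    (fun _ _ _ => by ext; simp) (fun _ _ _ => by ext; simp)

@[simp] theorem frobeniusLift_tmul (π : U →ₗ[k] S) (u x : U) (v : V) :
    frobeniusLift π ρ (u ⊗ₜ v) x = ρ (π (x * u)) v := by
  simp [frobeniusLift]

variable [Fintype ι]

theorem exists_mk_eq (hr : span k {u | ∃ a w, u = E a * φ w} = ⊤) (x : U ⊗[k] V) :
    ∃ y : ι → V, (∑ a, E a ⊗ₜ[k] y a) - x ∈
      span k {x | ∃ (u : U) (w : S) (v : V), x = (u * φ w) ⊗ₜ[k] v - u ⊗ₜ[k] (ρt w v)} := by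
  classical
  let I := span k {x | ∃ (u : U) (w : S) (v : V), x = (u * φ w) ⊗ₜ[k] v - u ⊗ₜ[k] (ρt w v)}
  let R : (ι → V) →ₗ[k] (U ⊗[k] V ⧸ I) :=
    I.mkQ ∘ₗ ∑ a, TensorProduct.mk k U V (E a) ∘ₗ LinearMap.proj a
  have hR (y : ι → V) : R y = I.mkQ (∑ a, E a ⊗ₜ[k] y a) := by
    simp [R]
  suffices I.mkQ x ∈ LinearMap.range R by
    obtain ⟨y, hy⟩ := this
    exact ⟨y, (Submodule.Quotient.eq I).1 ((hR y).symm.trans hy)⟩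
  induction x using TensorProduct.induction_on with
  | zero => simp
  | add x y hx hy => rw [map_add]; exact add_mem hx hy
  | tmul u v =>
    have hu : u ∈ span k {u | ∃ a w, u = E a * φ w} := by rw [hr]; trivial
    induction hu using span_induction with
    | zero => simp
    | add x y _ _ hx hy => rw [TensorProduct.add_tmul, map_add]; exact add_mem hx hy
    | smul r x _ hx => rw [← TensorProduct.smul_tmul', map_smul]; exact smul_mem _ _ hx
    | mem u hu =>
      obtain ⟨a, w, rfl⟩ := hu
      refine ⟨Pi.single a (ρt w v), ?_⟩
      rw [hR, Finset.sum_eq_single a (fun b _ hb => by simp [hb]) (by simp), Pi.single_eq_same]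
      exact ((Submodule.Quotient.eq I).2 (subset_span ⟨_, _, _, rfl⟩)).symm

/-- For a Frobenius extension twisted by an automorphism, the induced module is isomorphic to the
coinduced module. -/
theorem exists_equiv_of_frobenius {t : ι} {π : U →ₗ[k] S} (deg : ι → ℕ) (σ : Equiv.Perm ι)
    (hl : span k {u | ∃ w a, u = φ w * E a} = ⊤) (hr : span k {u | ∃ a w, u = E a * φ w} = ⊤)
    (hπ : ∀ w u, π (φ w * u) = w * π u)
    (hπt : ∀ u w v, ρ (π (u * φ w)) v = ρ (π u) (ρt w v))
    (ht : π (E t) = 1) (ht' : ∀ a, a ≠ t → π (E a) = 0)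
    (h1 : ∀ b, π (E (σ b) * E b) = 1)
    (h0 : ∀ a b, a ≠ b → deg a ≤ deg b → π (E (σ b) * E a) = 0) :
    ∃ Φ : (U ⊗[k] V ⧸ span k {x : U ⊗[k] V |
        ∃ (u : U) (w : S) (v : V), x = (u * φ w) ⊗ₜ[k] v - u ⊗ₜ[k] (ρt w v)}) →ₗ[k] (U →ₗ[k] V),
      (∀ ξ w u, Φ ξ (φ w * u) = ρ w (Φ ξ u)) ∧
      (∀ (u₀ : U) (x : U ⊗[k] V),
        Φ (Submodule.Quotient.mk (LinearMap.rTensor V (LinearMap.mulLeft k u₀) x))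
          = (Φ (Submodule.Quotient.mk x)) ∘ₗ LinearMap.mulRight k u₀) ∧
      Function.Injective Φ ∧
      (∀ lam : U →ₗ[k] V, (∀ w u, lam (φ w * u) = ρ w (lam u)) → ∃ ξ, Φ ξ = lam) ∧
      (∀ v : V, (∀ a, a ≠ t → Φ (Submodule.Quotient.mk ((1 : U) ⊗ₜ[k] v)) (E a) = 0) ∧
        Φ (Submodule.Quotient.mk ((1 : U) ⊗ₜ[k] v)) (E t) = v) ∧
      (∀ (v : V) (lam : U →ₗ[k] V), (∀ w u, lam (φ w * u) = ρ w (lam u)) →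
        (∀ a, a ≠ t → lam (E a) = 0) → lam (E t) = v →
        lam = Φ (Submodule.Quotient.mk ((1 : U) ⊗ₜ[k] v))) := by
  classical
  have hker : span k {x : U ⊗[k] V |
      ∃ (u : U) (w : S) (v : V), x = (u * φ w) ⊗ₜ[k] v - u ⊗ₜ[k] (ρt w v)} ≤
      LinearMap.ker (frobeniusLift π ρ) := by
    rw [span_le]
    rintro _ ⟨u, w, v, rfl⟩
    ext x
    simp [← mul_assoc, hπt]
  have hsemi (x : U ⊗[k] V) (w : S) (u : U) :
      frobeniusLift π ρ x (φ w * u) = ρ w (frobeniusLift π ρ x u) := by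
    induction x using TensorProduct.induction_on with
    | zero => simp
    | add x y hx hy => simp [hx, hy]
    | tmul u' v => simp [mul_assoc, hπ]
  have hT : Function.Bijective (LinearMap.pi fun b =>
      ∑ a, ρ (π (E (σ b) * E a)) ∘ₗ LinearMap.proj a : (ι → V) →ₗ[k] (ι → V)) :=
    bijective_of_triangular deg (fun b => by rw [h1, map_one])
      fun a b hab hd => by rw [h0 a b hab hd, map_zero]
  have hTa (y : ι → V) (b : ι) : (LinearMap.pi fun b =>
      ∑ a, ρ (π (E (σ b) * E a)) ∘ₗ LinearMap.proj a : (ι → V) →ₗ[k] (ι → V)) y b =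
      frobeniusLift π ρ (∑ a, E a ⊗ₜ[k] y a) (E (σ b)) := by
    simp
  have hmk (x : U ⊗[k] V) (u : U) :
      liftQ _ (frobeniusLift π ρ) hker (Submodule.Quotient.mk x) u = frobeniusLift π ρ x u := by
    rw [liftQ_apply]
  have hone (v : V) (a : ι) : frobeniusLift π ρ (1 ⊗ₜ v) (E a) = if a = t then v else 0 := by
    split_ifs with h
    · simp [h, ht]
    · simp [ht' a h]
  refine ⟨liftQ _ (frobeniusLift π ρ) hker, fun ξ w u => ?_, fun u₀ x => ?_, ?_,
    fun lam hlam => ?_, fun v => ⟨fun a ha => ?_, ?_⟩, fun v lam hlam h0 hv => ?_⟩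
  · obtain ⟨x, rfl⟩ := Submodule.Quotient.mk_surjective _ ξ
    exact hsemi x w u
  · ext u
    rw [LinearMap.comp_apply, hmk, hmk]
    induction x using TensorProduct.induction_on with
    | zero => simp
    | add x y hx hy => simp only [map_add, LinearMap.add_apply, hx, hy]
    | tmul u' v => simp [mul_assoc]
  · refine (injective_iff_map_eq_zero _).2 fun ξ hξ => ?_
    obtain ⟨x, rfl⟩ := Submodule.Quotient.mk_surjective _ ξ
    obtain ⟨y, hy⟩ := exists_mk_eq (ρt := ρt) hr x
    rw [← (Submodule.Quotient.eq _).2 hy] at hξ ⊢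
    have : y = 0 := hT.1 (by
      ext b
      rw [hTa, ← hmk, hξ]
      simp)
    simp [this]
  · obtain ⟨y, hy⟩ := hT.2 fun b => lam (E (σ b))
    refine ⟨Submodule.Quotient.mk (∑ a, E a ⊗ₜ[k] y a),
      eq_of_semilinear hl (hsemi _) hlam fun a => ?_⟩
    obtain ⟨b, rfl⟩ := σ.surjective a
    rw [hmk, ← hTa, hy]
  · rw [hmk, hone, if_neg ha]
  · rw [hmk, hone, if_pos rfl]
  · refine eq_of_semilinear hl hlam (hsemi ((1 : U) ⊗ₜ v)) fun a => ?_
    rw [hmk, hone]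
    split_ifs with h
    · rw [h, hv]
    · exact h0 a h

end Frobenius

end RestrictedPBW

namespace RestrictedPBW

variable {k : Type*} [Field k] {L : Type*} [LieRing L] [LieAlgebra k L] {p : ℕ} {pOp : L → L}
  {H : LieSubalgebra k L} {pOpH : H → H} {n : ℕ} {e : Fin n → L} {J : Type*}
  {φ : RUEA k H p pOpH →ₐ[k] RUEA k L p pOp}

theorem left_span [LinearOrder J] [WellFoundedLT J] (hp : 2 ≤ p)
    (hpOpH : ∀ h : H, (pOpH h : L) = pOp (h : L))
    (hφ : ∀ h : H, φ (rι k p pOpH h) = rι k p pOp (h : L)) {c : J → H}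
    (hc : span k (Set.range c) = ⊤)
    (hsp : span k (Set.range fun i => Submodule.Quotient.mk (p := H.toSubmodule) (e i)) = ⊤) :
    span k {u | ∃ w a, u = φ w * eMonR k p pOp e a} = ⊤ := by
  rw [eq_top_iff, ← range_mon_span (pOp := pOp) (span_subFam hc hsp), span_le]
  rintro _ ⟨w, rfl⟩
  refine span_mono ?_ (subFilt_le hc hsp hp hpOpH hφ ((w.map subWeight).sum + 1)
    (mon_mem_filt (Nat.lt_succ_self _)))
  rintro _ ⟨w, a, -, rfl⟩
  exact ⟨w, a, rfl⟩

/-- The coordinate at the top monomial in the left `U'(𝔥)`-module `U'(𝔤)`. -/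
theorem exists_frobenius_functional [LinearOrder J] [WellFoundedLT J]
    (hp : 2 < p) [CharP k p] [Fact p.Prime]
    (hi : ∀ x y : L, ⁅pOp x, y⁆ = (LieAlgebra.ad k L x ^ p) y)
    (hii : ∀ (c : k) (x : L), pOp (c • x) = c ^ p • pOp x)
    (hiii : ∀ x y : L,
      UniversalEnvelopingAlgebra.ι k (pOp (x + y)) - UniversalEnvelopingAlgebra.ι k (pOp x)
          - UniversalEnvelopingAlgebra.ι k (pOp y)
        = UniversalEnvelopingAlgebra.ι k (x + y) ^ p - UniversalEnvelopingAlgebra.ι k x ^ p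
          - UniversalEnvelopingAlgebra.ι k y ^ p)
    (hpOpH : ∀ h : H, (pOpH h : L) = pOp (h : L))
    (hφ : ∀ h : H, φ (rι k p pOpH h) = rι k p pOp (h : L)) (c : Module.Basis J k H)
    (hli : LinearIndependent k (fun i => Submodule.Quotient.mk (p := H.toSubmodule) (e i)))
    (hsp : span k (Set.range fun i => Submodule.Quotient.mk (p := H.toSubmodule) (e i)) = ⊤)
    {t : Fin n → Fin p} (ht : ∀ i, (t i : ℕ) = p - 1) :
    ∃ π : RUEA k L p pOp →ₗ[k] RUEA k H p pOpH,
      (∀ w u, π (φ w * u) = w * π u) ∧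
      (∀ a, π (eMonR k p pOp e a) = if a = t then 1 else 0) ∧
      (∀ u ∈ subFilt k p pOp c e (n * (p - 1)), π u = 0) ∧
      ∀ u (h : H), π (u * rι k p pOp (h : L)) =
        π u * (rι k p pOpH h + algebraMap k _ (trad H h)) := by
  obtain ⟨π, hπ⟩ := exists_leftCoordinates (e := e) hp hi hii hiii hφ c hli hsp
  have hl := left_span hp.le hpOpH hφ c.span_eq hsp
  have h1 (w : RUEA k H p pOpH) (a : Fin n → Fin p) :
      π t (φ w * eMonR k p pOp e a) = if a = t then w else 0 := by
    simp only [hπ, eq_comm]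
  have h2 (w : RUEA k H p pOpH) (u : RUEA k L p pOp) : π t (φ w * u) = w * π t u := by
    have : π t ∘ₗ LinearMap.mulLeft k (φ w) = LinearMap.mulLeft k w ∘ₗ π t := by
      refine LinearMap.ext_on hl ?_
      rintro _ ⟨w', a, rfl⟩
      simp [← mul_assoc, ← map_mul, h1]
    exact LinearMap.congr_fun this u
  have h3 (a : Fin n → Fin p) : π t (eMonR k p pOp e a) = if a = t then 1 else 0 := by
    simpa using h1 1 a
  have h4 : ∀ u ∈ subFilt k p pOp c e (n * (p - 1)), π t u = 0 := by
    suffices subFilt k p pOp c e (n * (p - 1)) ≤ LinearMap.ker (π t) from fun u hu => this hu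
    refine (subFilt_le c.span_eq hsp hp.le hpOpH hφ _).trans (span_le.2 ?_)
    rintro _ ⟨w, a, ha, rfl⟩
    have hat : a ≠ t := by
      rintro rfl
      simp [ht] at ha
    simp [h1, hat]
  refine ⟨π t, h2, h3, h4, fun u h => ?_⟩
  have : π t ∘ₗ LinearMap.mulRight k (rι k p pOp (h : L)) =
      LinearMap.mulRight k (rι k p pOpH h + algebraMap k _ (trad H h)) ∘ₗ π t := by
    refine LinearMap.ext_on hl ?_
    rintro _ ⟨w, a, rfl⟩
    simp only [LinearMap.comp_apply, LinearMap.mulRight_apply]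
    rw [mul_assoc, h2, h2, mul_assoc, h3]
    congr 1
    split_ifs with hat
    · have := h4 _ (top_mul_sub_mem_subFilt (pOp := pOp) c.span_eq hp.le hli hsp ht h)
      rw [map_sub, map_sub, ← hφ, h2, map_smul, h3, if_pos rfl, sub_sub, sub_eq_zero] at this
      rw [hat, ← hφ, this, one_mul, mul_one, Algebra.smul_def, mul_one]
    · rw [zero_mul]
      obtain ⟨i, hi⟩ := Function.ne_iff.1 hat
      refine h4 _ (mul_mem_filt (d := n * (p - 1)) (d' := 1) le_rfl ?_
        (coe_mem_subFilt c.span_eq h le_rfl))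
      rw [← mon_multWord]
      refine mon_mem_subFilt _ ?_
      rw [length_multWord]
      calc ∑ j, (a j : ℕ) < ∑ _j : Fin n, (p - 1) :=
            Finset.sum_lt_sum (fun j _ => Nat.le_sub_one_of_lt (a j).2) ⟨i, Finset.mem_univ _,
              lt_of_le_of_ne (Nat.le_sub_one_of_lt (a i).2)
                fun h => hi (Fin.ext (h.trans (ht i).symm))⟩
        _ = n * (p - 1) := by simp
  exact LinearMap.congr_fun this u

theorem dual_mul_mem {c : J → H} (hc : span k (Set.range c) = ⊤)
    (hsp : span k (Set.range fun i => Submodule.Quotient.mk (p := H.toSubmodule) (e i)) = ⊤)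
    (hp : 2 ≤ p) {a b : Fin n → Fin p} (hab : a ≠ b) (hd : ∑ i, (a i : ℕ) ≤ ∑ i, (b i : ℕ)) :
    eMonR k p pOp e (fun i => (b i).rev) * eMonR k p pOp e a
      ∈ subFilt k p pOp c e (n * (p - 1)) := by
  obtain ⟨i, hi⟩ := Function.ne_iff.1 hab
  rw [← mon_multWord, ← mon_multWord, ← mon_append]
  refine mon_mem_subFilt_of_count_ne hc hsp hp ?_ (i := i) ?_
  · rw [List.length_append, length_multWord, length_multWord]
    have : ∑ i, ((b i).rev : ℕ) + ∑ i, (b i : ℕ) = n * (p - 1) := by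
      rw [← Finset.sum_add_distrib]
      calc ∑ i, (((b i).rev : ℕ) + (b i : ℕ)) = ∑ _i : Fin n, (p - 1) :=
            Finset.sum_congr rfl fun i _ => by rw [Fin.val_rev]; omega
        _ = n * (p - 1) := by simp
    omega
  · rw [List.count_append, count_multWord, count_multWord, Fin.val_rev]
    have := Fin.val_ne_of_ne hi
    omega

theorem dual_mul_sub_mem {c : J → H} (hc : span k (Set.range c) = ⊤)
    (hsp : span k (Set.range fun i => Submodule.Quotient.mk (p := H.toSubmodule) (e i)) = ⊤)
    {t : Fin n → Fin p} (ht : ∀ i, (t i : ℕ) = p - 1) (b : Fin n → Fin p) :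
    eMonR k p pOp e (fun i => (b i).rev) * eMonR k p pOp e b - eMonR k p pOp e t
      ∈ subFilt k p pOp c e (n * (p - 1)) := by
  have hperm : (multWord (fun i => (b i).rev) ++ multWord b).Perm (multWord t) := by
    refine List.perm_iff_count.2 fun i => ?_
    rw [List.count_append, count_multWord, count_multWord, count_multWord, Fin.val_rev, ht]
    omega
  rw [← mon_multWord, ← mon_multWord, ← mon_multWord, ← mon_append]
  refine mon_sub_mon_mem_of_perm hc hsp hperm ?_
  rw [hperm.length_eq, length_multWord]
  simp [ht]

end RestrictedPBW

end

/-- `Ind'(V ⊗ k_{trad_{𝔤/𝔥}}) ≅ Coind'(V)` for restricted Lie algebras: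
there is a `U'(𝔤)`-module isomorphism `Φ` (from the quotient presenting the induced
module, onto the coinduced set, intertwining left multiplication with the coinduced
action) such that `Φ(1 ⊗ v)` is the unique `U'(𝔥)`-linear map `λ_v : U'(𝔤) → V`
vanishing on the monomials `e^a`, `a ≠ (p−1,…,p−1)`, and sending `e^{(p−1,…,p−1)}`
to `v`.  Here `ρt` is the module structure of `V ⊗ k_{trad_{𝔤/𝔥}}`, characterized
on generators by `ρt(h) v = ρ(h) v + trad(h) • v`. -/
theorem statement13
    {k : Type*} [Field k] {L : Type*} [LieRing L] [LieAlgebra k L]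
    (p : ℕ) [CharP k p] (hp : 2 < p)
    (pOp : L → L)
    (hi : ∀ x y : L, ⁅pOp x, y⁆ = (LieAlgebra.ad k L x ^ p) y)
    (hii : ∀ (c : k) (x : L), pOp (c • x) = c ^ p • pOp x)
    (hiii : ∀ x y : L,
      UniversalEnvelopingAlgebra.ι k (pOp (x + y)) - UniversalEnvelopingAlgebra.ι k (pOp x)
          - UniversalEnvelopingAlgebra.ι k (pOp y)
        = UniversalEnvelopingAlgebra.ι k (x + y) ^ p - UniversalEnvelopingAlgebra.ι k x ^ p
          - UniversalEnvelopingAlgebra.ι k y ^ p)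
    (H : LieSubalgebra k L) [FiniteDimensional k (L ⧸ H.toSubmodule)]
    (pOpH : H → H) (hpOpH : ∀ h : H, (pOpH h : L) = pOp (h : L))
    (φ : RUEA k H p pOpH →ₐ[k] RUEA k L p pOp)
    (hφ : ∀ h : H, φ (rι k p pOpH h) = rι k p pOp (h : L))
    (n : ℕ) (e : Fin n → L)
    (hli : LinearIndependent k
      (fun i => Submodule.Quotient.mk (p := H.toSubmodule) (e i)))
    (hsp : Submodule.span k
      (Set.range fun i => Submodule.Quotient.mk (p := H.toSubmodule) (e i)) = ⊤)
    {V : Type*} [AddCommGroup V] [Module k V]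
    (ρ : RUEA k H p pOpH →ₐ[k] Module.End k V)
    (ρt : RUEA k H p pOpH →ₐ[k] Module.End k V)
    (hρt : ∀ (h : H) (v : V),
      ρt (rι k p pOpH h) v = ρ (rι k p pOpH h) v + trad H h • v) :
    ∃ Φ : ((RUEA k L p pOp ⊗[k] V) ⧸ rIndRel p pOp φ ρt) →ₗ[k]
        (RUEA k L p pOp →ₗ[k] V),
      (∀ ξ, Φ ξ ∈ rCoindSet p pOp φ ρ) ∧
      (∀ (u₀ : RUEA k L p pOp) (x : RUEA k L p pOp ⊗[k] V),
        Φ (Submodule.Quotient.mk (LinearMap.rTensor V (LinearMap.mulLeft k u₀) x))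
          = (Φ (Submodule.Quotient.mk x)) ∘ₗ LinearMap.mulRight k u₀) ∧
      Function.Injective Φ ∧
      (∀ lam ∈ rCoindSet p pOp φ ρ, ∃ ξ, Φ ξ = lam) ∧
      (∀ v : V,
        (∀ a : Fin n → Fin p, a ≠ (fun _ => (⟨p - 1, by omega⟩ : Fin p)) →
          Φ (Submodule.Quotient.mk ((1 : RUEA k L p pOp) ⊗ₜ[k] v)) (eMonR k p pOp e a) = 0) ∧
        Φ (Submodule.Quotient.mk ((1 : RUEA k L p pOp) ⊗ₜ[k] v))
            (eMonR k p pOp e (fun _ => (⟨p - 1, by omega⟩ : Fin p))) = v) ∧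
      (∀ (v : V), ∀ lam ∈ rCoindSet p pOp φ ρ,
        (∀ a : Fin n → Fin p, a ≠ (fun _ => (⟨p - 1, by omega⟩ : Fin p)) →
          lam (eMonR k p pOp e a) = 0) →
        lam (eMonR k p pOp e (fun _ => (⟨p - 1, by omega⟩ : Fin p))) = v →
        lam = Φ (Submodule.Quotient.mk ((1 : RUEA k L p pOp) ⊗ₜ[k] v))) := by
  have : Fact p.Prime := ⟨(CharP.char_is_prime_or_zero k p).resolve_right (by omega)⟩
  obtain ⟨_, _⟩ := exists_wellFoundedLT (Module.Basis.ofVectorSpaceIndex k H)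
  let c := Module.Basis.ofVectorSpace k H
  obtain ⟨π, hπ, hE, hF, hr⟩ := RestrictedPBW.exists_frobenius_functional hp hi hii hiii hpOpH hφ c
    hli hsp (t := fun _ => ⟨p - 1, by omega⟩) fun _ => rfl
  have hπt (u : RUEA k L p pOp) (w : RUEA k H p pOpH) (v : V) :
      ρ (π (u * φ w)) v = ρ (π u) (ρt w v) := by
    let S : Subalgebra k (RUEA k H p pOpH) :=
      { carrier := {w | ∀ u v, ρ (π (u * φ w)) v = ρ (π u) (ρt w v)}
        mul_mem' := fun {a b} ha hb u v => by
          rw [map_mul φ, ← mul_assoc, hb, ha, map_mul ρt, Module.End.mul_apply]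
        add_mem' := fun {a b} ha hb u v => by
          simp only [map_add, mul_add, LinearMap.add_apply, ha u v, hb u v]
        algebraMap_mem' := fun r u v => by
          simp [Algebra.algebraMap_eq_smul_one] }
    have hS : S = ⊤ := RestrictedPBW.subalgebra_eq_top fun h u v => by
      rw [hφ, hr, map_mul, map_add, Module.End.mul_apply, hρt]
      simp
    have hw : w ∈ S := by rw [hS]; trivial
    exact hw u v
  exact RestrictedPBW.exists_equiv_of_frobenius (t := fun _ => ⟨p - 1, by omega⟩) (π := π)
    (E := eMonR k p pOp e) (fun a => ∑ i, (a i : ℕ)) (Equiv.piCongrRight fun _ => Fin.revPerm)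
    (RestrictedPBW.left_span hp.le hpOpH hφ c.span_eq hsp)
    (RestrictedPBW.right_span hp.le hφ c.span_eq hsp) hπ hπt
    ((hE _).trans (if_pos rfl)) (fun a ha => (hE a).trans (if_neg ha))
    (fun b => (sub_eq_zero.1 ((map_sub π _ _).symm.trans (hF _
      (RestrictedPBW.dual_mul_sub_mem c.span_eq hsp (fun _ => rfl) b)))).trans
        ((hE _).trans (if_pos rfl)))
    (fun a b hab hd => hF _ (RestrictedPBW.dual_mul_mem c.span_eq hsp hp.le hab hd))
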